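/- arXiv:2111.10809 — 10 statements merged into one kernel-verified Lean document; each statement's English description precedes it below -/
import Mathlib

section
/- Let S ∈ ℚ[x,y] be a squarefree polynomial, M ∈ ℚ[x,y] a polynomial dividing some power of S, and P ∈ ℚ[z] a nonzero squarefree univariate polynomial (all complex roots of multiplicity < 2) having at least three distinct complex roots. If J, V ∈ ℚ(x,y) both lie in ℚ[x,y,S⁻¹] and satisfy P(J) = V² · M, then max(deg num(J), deg den(J)) ≤ 6 · max(0, deg S − 1). -/
open MvPolynomial

namespace Polynomial

theorem wronskian_sub_C_mul_left {R : Type*} [CommRing R] (f g : R[X]) (a : R) :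
    wronskian (f - C a * g) g = wronskian f g := by
  simp only [wronskian, derivative_sub, derivative_C_mul]
  ring

theorem wronskian_sub_C_mul_sub_C_mul {R : Type*} [CommRing R] (f g : R[X]) (a b : R) :
    wronskian (f - C a * g) (f - C b * g) = C (a - b) * wronskian f g := by
  simp only [wronskian, derivative_sub, derivative_C_mul, C_sub]
  ring

theorem rootMultiplicity_le_rootMultiplicity_wronskian_add_one {R : Type*} [CommRing R]
    {f g : R[X]} (hw : wronskian f g ≠ 0) (t : R) :
    f.rootMultiplicity t ≤ (wronskian f g).rootMultiplicity t + 1 := by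
  have h := pow_rootMultiplicity_dvd f t
  have h' := pow_sub_one_dvd_derivative_of_pow_dvd h
  have hdvd : (X - C t) ^ (f.rootMultiplicity t - 1) ∣ wronskian f g :=
    dvd_sub (((pow_dvd_pow _ (Nat.sub_le _ 1)).trans h).mul_right _) (h'.mul_right _)
  have := (le_rootMultiplicity_iff hw).2 hdvd
  omega

theorem dvd_of_forall_rootMultiplicity_le {L : Type*} [Field L] [IsAlgClosed L] {f g : L[X]}
    (hf : f ≠ 0) (h : ∀ t, f.rootMultiplicity t ≤ g.rootMultiplicity t) : f ∣ g := by
  classical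
  refine (IsAlgClosed.splits f).dvd_of_roots_le_roots hf ?_
  rw [Multiset.le_iff_count]
  simpa only [count_roots] using h

theorem dvd_wronskian_mul_of_forall_isRoot {L : Type*} [Field L] [IsAlgClosed L] {f g s : L[X]}
    (hw : wronskian f g ≠ 0) (hs : s ≠ 0) (h : ∀ t, f.IsRoot t → s.IsRoot t) :
    f ∣ wronskian f g * s := by
  have hf : f ≠ 0 := by rintro rfl; simp at hw
  refine dvd_of_forall_rootMultiplicity_le hf fun t ↦ ?_
  rw [rootMultiplicity_mul (mul_ne_zero hw hs)]
  by_cases ht : f.IsRoot t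
  · have := (rootMultiplicity_pos hs).2 (h t ht)
    have := rootMultiplicity_le_rootMultiplicity_wronskian_add_one hw t
    omega
  · simp [rootMultiplicity_eq_zero ht]

theorem dvd_wronskian_sq_mul_sq_of_even {L : Type*} [Field L] [IsAlgClosed L] {f g s : L[X]}
    (hw : wronskian f g ≠ 0) (hs : s ≠ 0)
    (h : ∀ t, f.IsRoot t → ¬ s.IsRoot t → Even (f.rootMultiplicity t)) :
    f ∣ (wronskian f g * s) ^ 2 := by
  have hf : f ≠ 0 := by rintro rfl; simp at hw
  have hws := mul_ne_zero hw hs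
  refine dvd_of_forall_rootMultiplicity_le hf fun t ↦ ?_
  rw [sq, rootMultiplicity_mul (mul_ne_zero hws hws), rootMultiplicity_mul hws]
  by_cases ht : f.IsRoot t
  · have h1 := rootMultiplicity_le_rootMultiplicity_wronskian_add_one hw t
    have h2 := (rootMultiplicity_pos hf).2 ht
    by_cases hst : s.IsRoot t
    · have := (rootMultiplicity_pos hs).2 hst
      omega
    · obtain ⟨k, hk⟩ := h t ht hst
      omega
  · simp [rootMultiplicity_eq_zero ht]

theorem _root_.IsCoprime.sub_C_mul_left {R : Type*} [CommRing R] {f g : R[X]} (h : IsCoprime f g)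
    (a : R) : IsCoprime (f - C a * g) g := by
  simpa [sub_eq_add_neg, mul_comm] using h.add_mul_left_left (-C a)

theorem _root_.IsCoprime.sub_C_mul_sub_C_mul {L : Type*} [Field L] {f g : L[X]} (h : IsCoprime f g)
    {a b : L} (hab : a ≠ b) : IsCoprime (f - C a * g) (f - C b * g) := by
  have h1 : IsCoprime (f - C a * g) (C (a - b) * g) :=
    (isCoprime_mul_unit_left_right ((isUnit_C).2 (sub_ne_zero.2 hab).isUnit) _ _).2
      (IsCoprime.sub_C_mul_left h a)
  have h2 := h1.add_mul_left_right 1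
  have h3 : C (a - b) * g + (f - C a * g) * 1 = f - C b * g := by rw [C_sub]; ring
  rwa [h3] at h2

/-- Four members of the pencil spanned by coprime `f` and `g`: three of them with even ramification
away from the zeros of `s`, the fourth vanishing only at zeros of `s`. -/
theorem max_natDegree_add_two_le_of_even {L : Type*} [Field L] [IsAlgClosed L] {f g s : L[X]}
    (hfg : IsCoprime f g) (hw : wronskian f g ≠ 0) (hs : s ≠ 0) {a b c : L}
    (hab : a ≠ b) (hac : a ≠ c) (hbc : b ≠ c)
    (hg : ∀ t, g.IsRoot t → s.IsRoot t)
    (h : ∀ z ∈ ({a, b, c} : Set L), ∀ t, (f - C z * g).IsRoot t → ¬ s.IsRoot t →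
      Even ((f - C z * g).rootMultiplicity t)) :
    max f.natDegree g.natDegree + 2 ≤ 2 * s.natDegree := by
  have hdvd : ∀ z ∈ ({a, b, c} : Set L), f - C z * g ∣ (wronskian f g * s) ^ 2 := fun z hz ↦ by
    have := dvd_wronskian_sq_mul_sq_of_even (f := f - C z * g) (g := g) (s := s)
      (by rwa [wronskian_sub_C_mul_left]) hs (h z hz)
    rwa [wronskian_sub_C_mul_left] at this
  have hgd : g ^ 2 ∣ (wronskian f g * s) ^ 2 := by
    refine pow_dvd_pow_of_dvd ?_ 2
    have hw' : wronskian g f ≠ 0 := by rwa [← wronskian_neg_eq, neg_ne_zero]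
    have := dvd_wronskian_mul_of_forall_isRoot hw' hs hg
    rwa [← wronskian_neg_eq, neg_mul, dvd_neg] at this
  have hcop : ∀ z, IsCoprime (f - C z * g) (g ^ 2) := fun z ↦
    (IsCoprime.sub_C_mul_left hfg z).pow_right
  have hprod : (f - C a * g) * (f - C b * g) * (f - C c * g) * g ^ 2 ∣
      (wronskian f g * s) ^ 2 := by
    refine IsCoprime.mul_dvd (((hcop a).mul_left (hcop b)).mul_left (hcop c)) ?_ hgd
    refine IsCoprime.mul_dvd ((IsCoprime.sub_C_mul_sub_C_mul hfg hac).mul_left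
      (IsCoprime.sub_C_mul_sub_C_mul hfg hbc)) ?_ (hdvd c (by simp))
    exact IsCoprime.mul_dvd (IsCoprime.sub_C_mul_sub_C_mul hfg hab) (hdvd a (by simp))
      (hdvd b (by simp))
  have hne : ∀ z, f - C z * g ≠ 0 := fun z hz ↦ by
    rw [← wronskian_sub_C_mul_left f g z, hz] at hw; simp at hw
  have hg0 : g ≠ 0 := by rintro rfl; simp at hw
  have hdeg := natDegree_le_of_dvd hprod (pow_ne_zero 2 (mul_ne_zero hw hs))
  rw [natDegree_mul (by simp [hne]) (by simp [hg0]),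
    natDegree_mul (by simp [hne]) (hne c), natDegree_mul (hne a) (hne b), natDegree_pow,
    natDegree_pow, natDegree_mul hw hs] at hdeg
  have hwg : ∀ z, (wronskian f g).natDegree < (f - C z * g).natDegree + g.natDegree := fun z ↦ by
    rw [← wronskian_sub_C_mul_left f g z]
    exact natDegree_wronskian_lt_add (by rwa [wronskian_sub_C_mul_left])
  have hww : ∀ y z, y ≠ z → (wronskian f g).natDegree <
      (f - C y * g).natDegree + (f - C z * g).natDegree := fun y z hyz ↦ by
    rw [← natDegree_C_mul (sub_ne_zero.2 hyz), ← wronskian_sub_C_mul_sub_C_mul]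
    exact natDegree_wronskian_lt_add (by
      rw [wronskian_sub_C_mul_sub_C_mul]
      exact mul_ne_zero (C_ne_zero.2 (sub_ne_zero.2 hyz)) hw)
  have hf : ∀ z, f.natDegree ≤ max (f - C z * g).natDegree g.natDegree := fun z ↦ by
    calc f.natDegree = (f - C z * g + C z * g).natDegree := by simp
      _ ≤ _ := (natDegree_add_le _ _).trans (max_le_max le_rfl (natDegree_C_mul_le _ _))
  have hz : ∀ z, (f - C z * g).natDegree ≤ max f.natDegree g.natDegree := fun z ↦
    (natDegree_sub_le _ _).trans (max_le_max le_rfl (natDegree_C_mul_le _ _))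
  have hgz : ∀ y z, y ≠ z →
      g.natDegree ≤ max (f - C y * g).natDegree (f - C z * g).natDegree := fun y z hyz ↦ by
    rw [← natDegree_C_mul (sub_ne_zero.2 hyz.symm)]
    have : C (z - y) * g = (f - C y * g) - (f - C z * g) := by rw [C_sub]; ring
    rw [this]
    exact natDegree_sub_le _ _
  have := hwg a; have := hwg b; have := hwg c
  have := hww a b hab; have := hww a c hac; have := hww b c hbc
  have := hf a; have := hf b; have := hf c
  have := hz a; have := hz b; have := hz c
  have := hgz a b hab; have := hgz a c hac; have := hgz b c hbc
  omega

end Polynomial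

namespace Polynomial

theorem max_natDegree_le_of_eval₂_eq {L F : Type*} [Field L] [IsAlgClosed L] [CharZero L]
    [Field F] [Algebra L[X] F] [IsFractionRing L[X] F] {f g s m w p : L[X]} {P : L[X]} {J V : F}
    (hP : P.Separable) (hdeg : 3 ≤ P.natDegree) (hs : s ≠ 0) {k l n : ℕ} (hm : m ∣ s ^ k)
    (hfg : IsCoprime f g) (hJfg : J * algebraMap _ F g = algebraMap _ F f)
    (hJ : algebraMap _ F s ^ l * J = algebraMap _ F p)
    (hV : algebraMap _ F s ^ n * V = algebraMap _ F w)
    (heq : P.eval₂ ((algebraMap L[X] F).comp C) J = V ^ 2 * algebraMap _ F m) :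
    max f.natDegree g.natDegree ≤ 2 * (s.natDegree - 1) := by
  classical
  by_cases hw : wronskian f g = 0
  · obtain ⟨hf', hg'⟩ := hfg.wronskian_eq_zero_iff.1 hw
    simp [derivative_eq_zero.1 hf', derivative_eq_zero.1 hg']
  have hinj : Function.Injective (algebraMap L[X] F) := IsFractionRing.injective _ _
  have hroots : P.roots.Nodup := nodup_roots hP
  have hcard : P.roots.card = P.natDegree := (IsAlgClosed.splits P).natDegree_eq_card_roots.symm
  have hid : C P.leadingCoeff * (P.roots.map fun z ↦ f - C z * g).prod * s ^ (2 * n) =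
      w ^ 2 * m * g ^ P.roots.card := by
    apply hinj
    have hprod : algebraMap L[X] F (P.roots.map fun z ↦ f - C z * g).prod =
        (P.roots.map fun z ↦ J - algebraMap _ F (C z)).prod * algebraMap _ F g ^ P.roots.card := by
      rw [map_multiset_prod, Multiset.map_map]
      rw [← Multiset.prod_replicate, ← Multiset.map_const', ← Multiset.prod_map_mul]
      refine congrArg _ (Multiset.map_congr rfl fun z _ ↦ ?_)
      simp [sub_mul, hJfg]
    have hPJ : P.eval₂ ((algebraMap L[X] F).comp C) J = algebraMap _ F (C P.leadingCoeff) *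
        (P.roots.map fun z ↦ J - algebraMap _ F (C z)).prod := by
      conv_lhs => rw [(IsAlgClosed.splits P).eq_prod_roots]
      rw [eval₂_mul, eval₂_C, eval₂_multiset_prod, Multiset.map_map]
      simp
    simp only [map_mul, map_pow, hprod]
    rw [← hV]
    linear_combination (algebraMap L[X] F s ^ (2 * n) * algebraMap L[X] F g ^ P.roots.card) *
      (heq - hPJ)
  have hne : ∀ z, f - C z * g ≠ 0 := fun z hz ↦ by
    rw [← wronskian_sub_C_mul_left f g z, hz] at hw; simp at hw
  have hpow : ∀ (q : L[X]) (i : ℕ) (t : L), (q ^ i).IsRoot t → q.IsRoot t := fun q i t h ↦ by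
    rw [IsRoot, eval_pow] at h
    exact eq_zero_of_pow_eq_zero h
  have hgs : g ∣ s ^ l := by
    refine hfg.symm.dvd_of_dvd_mul_right (z := f) ?_
    refine ⟨p, hinj ?_⟩
    rw [map_mul, map_mul, map_pow, ← hJ, ← hJfg]
    ring
  have hgs' : ∀ t, g.IsRoot t → s.IsRoot t := fun t ht ↦
    hpow s l t (ht.dvd hgs)
  have heven : ∀ z ∈ P.roots, ∀ t, (f - C z * g).IsRoot t → ¬ s.IsRoot t →
      Even ((f - C z * g).rootMultiplicity t) := by
    intro z hz t ht hst
    obtain ⟨R, hR⟩ := Multiset.exists_cons_of_mem hz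
    rw [hR, Multiset.nodup_cons] at hroots
    set Q := (R.map fun z ↦ f - C z * g).prod with hQ
    have hQt : ¬ Q.IsRoot t := by
      rw [IsRoot, hQ, eval_multiset_prod, Multiset.map_map, Multiset.prod_eq_zero_iff,
        Multiset.mem_map]
      rintro ⟨y, hy, hyt⟩
      have hyz : y ≠ z := by rintro rfl; exact hroots.1 hy
      obtain ⟨u, v, huv⟩ := IsCoprime.sub_C_mul_sub_C_mul hfg hyz
      have := congrArg (eval t) huv
      rw [eval_add, eval_mul, eval_mul, ht.eq_zero] at this
      simp only [Function.comp_apply] at hyt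
      simp [hyt] at this
    rw [hR, Multiset.map_cons, Multiset.prod_cons, ← hQ] at hid
    have hmt : ¬ m.IsRoot t := fun h ↦ hst (hpow s k t (h.dvd hm))
    have hgt : ¬ g.IsRoot t := fun h ↦ hst (hgs' t h)
    have hP0 : C P.leadingCoeff ≠ 0 := by simpa using hP.ne_zero
    have hQ0 : Q ≠ 0 := by rintro h; simp [h] at hQt
    have hL : C P.leadingCoeff * ((f - C z * g) * Q) * s ^ (2 * n) ≠ 0 :=
      mul_ne_zero (mul_ne_zero hP0 (mul_ne_zero (hne z) hQ0)) (pow_ne_zero _ hs)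
    have hcount := congrArg (rootMultiplicity t) hid
    have hR' := hid ▸ hL
    rw [rootMultiplicity_mul hL, rootMultiplicity_mul (left_ne_zero_of_mul hL),
      rootMultiplicity_mul (mul_ne_zero (hne z) hQ0), rootMultiplicity_mul hR',
      rootMultiplicity_mul (left_ne_zero_of_mul hR'), rootMultiplicity_eq_zero hQt,
      rootMultiplicity_eq_zero hmt, rootMultiplicity_C, sq,
      rootMultiplicity_mul (by rw [← sq]; exact left_ne_zero_of_mul (left_ne_zero_of_mul hR')),
      rootMultiplicity_eq_zero (p := s ^ (2 * n)) fun h ↦ hst (hpow _ _ _ h),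
      rootMultiplicity_eq_zero (p := g ^ _) fun h ↦ hgt (hpow _ _ _ h)] at hcount
    exact ⟨w.rootMultiplicity t, by omega⟩
  have h3 : 2 < P.roots.toFinset.card := by
    rw [Multiset.toFinset_card_of_nodup hroots, hcard]; omega
  obtain ⟨a, b, c, ha, hb, hc, hab, hac, hbc⟩ := Finset.two_lt_card_iff.1 h3
  rw [Multiset.mem_toFinset] at ha hb hc
  have := max_natDegree_add_two_le_of_even hfg hw hs hab hac hbc hgs' (by
    rintro z (rfl | rfl | rfl)
    exacts [heven _ ha, heven _ hb, heven _ hc])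
  omega

theorem separable_of_rootMultiplicity_lt_two {K L : Type*} [Field K] [Field L] [IsAlgClosed L]
    [Algebra K L] {P : K[X]} (hP : P ≠ 0)
    (h : ∀ z, (P.map (algebraMap K L)).rootMultiplicity z < 2) : P.Separable := by
  classical
  rw [← separable_map (algebraMap K L),
    ← nodup_roots_iff_of_splits (map_ne_zero hP) (IsAlgClosed.splits _),
    Multiset.nodup_iff_count_le_one]
  intro z
  rw [count_roots]
  exact Nat.lt_succ_iff.1 (h z)

theorem three_le_natDegree_of_aeval_eq_zero {K L : Type*} [Field K] [Field L] [Algebra K L]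
    {P : K[X]} (hP : P ≠ 0) {a b c : L} (hab : a ≠ b) (hac : a ≠ c) (hbc : b ≠ c)
    (ha : aeval a P = 0) (hb : aeval b P = 0) (hc : aeval c P = 0) : 3 ≤ P.natDegree := by
  classical
  have hsub : ({a, b, c} : Finset L) ⊆ (P.aroots L).toFinset := by
    intro z hz
    simp only [Finset.mem_insert, Finset.mem_singleton] at hz
    rw [Multiset.mem_toFinset, mem_aroots]
    rcases hz with rfl | rfl | rfl <;> exact ⟨hP, ‹_›⟩
  calc 3 = ({a, b, c} : Finset L).card :=
        (Finset.card_eq_three.2 ⟨a, b, c, hab, hac, hbc, rfl⟩).symm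
    _ ≤ (P.aroots L).toFinset.card := Finset.card_le_card hsub
    _ ≤ (P.aroots L).card := Multiset.toFinset_card_le _
    _ ≤ P.natDegree := (card_roots' _).trans natDegree_map_le

end Polynomial

/-- Relatively prime polynomials over a UFD are coprime over its fraction field. -/
theorem Polynomial.isCoprime_map_of_isRelPrime {R : Type*} [CommRing R] [IsDomain R]
    [UniqueFactorizationMonoid R] (K : Type*) [Field K] [Algebra R K] [IsFractionRing R K]
    {f g : Polynomial R} (h : IsRelPrime f g) (hg : g ≠ 0) :
    IsCoprime (f.map (algebraMap R K)) (g.map (algebraMap R K)) := by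
  classical
  let : NormalizedGCDMonoid R := Nonempty.some inferInstance
  rw [← isRelPrime_iff_isCoprime]
  intro d hdf hdg
  have hd : d ≠ 0 := by
    rintro rfl
    rw [zero_dvd_iff, Polynomial.map_eq_zero_iff (IsFractionRing.injective R K)] at hdg
    exact hg hdg
  set e := (IsLocalization.integerNormalization (nonZeroDivisors R) d) with he
  obtain ⟨c, c0, hc⟩ := IsLocalization.integerNormalization_spec (nonZeroDivisors R) d
  have hc0 : algebraMap R K c ≠ 0 := by
    simpa using nonZeroDivisors.ne_zero c0
  have hdvd : e.primPart.map (algebraMap R K) ∣ d := by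
    have h1 : e.primPart.map (algebraMap R K) ∣ e.map (algebraMap R K) :=
      Polynomial.map_dvd _ e.primPart_dvd
    rw [he, hc, Algebra.smul_def] at h1
    rw [Polynomial.algebraMap_apply] at h1
    exact ((Polynomial.isUnit_C.2 hc0.isUnit).dvd_mul_left).1 h1
  have hp := e.isPrimitive_primPart
  exact isUnit_or_eq_zero_of_isUnit_integerNormalization_primPart hd <|
    h (hp.dvd_of_fraction_map_dvd_fraction_map (K := K) (hdvd.trans hdf))
      (hp.dvd_of_fraction_map_dvd_fraction_map (K := K) (hdvd.trans hdg))

theorem Polynomial.coeff_prod_sum_of_natDegree_le {R ι : Type*} [CommSemiring R] (s : Finset ι)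
    (p : ι → Polynomial R) (n : ι → ℕ) (h : ∀ i ∈ s, (p i).natDegree ≤ n i) :
    (∏ i ∈ s, p i).coeff (∑ i ∈ s, n i) = ∏ i ∈ s, (p i).coeff (n i) := by
  classical
  induction s using Finset.induction_on with
  | empty => simp
  | insert a s ha ih =>
    rw [Finset.prod_insert ha, Finset.sum_insert ha, Finset.prod_insert ha,
      Polynomial.coeff_mul_add_eq_of_natDegree_le (h a (by simp)),
      ih fun i hi ↦ h i (by simp [hi])]
    exact (Polynomial.natDegree_prod_le _ _).trans
      (Finset.sum_le_sum fun i hi ↦ h i (by simp [hi]))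

namespace MvPolynomial

theorem IsHomogeneous.eval_mul_left {R σ : Type*} [CommSemiring R] {f : MvPolynomial σ R} {n : ℕ}
    (hf : f.IsHomogeneous n) (r : R) (x : σ → R) :
    eval (fun i ↦ r * x i) f = r ^ n * eval x f := by
  simp only [eval_eq, Finset.mul_sum]
  refine Finset.sum_congr rfl fun d hd ↦ ?_
  have hd' : ∑ i ∈ d.support, d i = n := by
    have := hf (mem_support_iff.1 hd)
    rwa [show (Finsupp.weight 1 : (σ →₀ ℕ) →+ ℕ) d = d.degree from
      (DFunLike.congr_fun (Finsupp.degree_eq_weight_one (σ := σ) (R := ℕ)) d).symm] at this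
  simp only [mul_pow, Finset.prod_mul_distrib, Finset.prod_pow_eq_pow_sum, hd']
  ring

/-- A nonzero form has a nonzero value at some `(1, c)`. -/
theorem IsHomogeneous.exists_eval_one_ne_zero {K : Type*} [Field K] [Infinite K]
    {f : MvPolynomial (Fin 2) K} {n : ℕ} (hf : f.IsHomogeneous n) (h0 : f ≠ 0) :
    ∃ c : K, eval ![1, c] f ≠ 0 := by
  by_contra! h
  have : X 0 * f = 0 := by
    refine MvPolynomial.funext fun x ↦ ?_
    rw [map_mul, eval_X, map_zero, mul_eq_zero, or_iff_not_imp_left]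
    intro hx
    have hx' : x = fun i ↦ x 0 * ![1, x 1 / x 0] i := by
      ext i; fin_cases i <;> simp [mul_div_cancel₀, hx]
    rw [hx', hf.eval_mul_left, h, mul_zero]
  simp [h0] at this

theorem coeff_aeval_linear {R A σ : Type*} [CommRing R] [CommRing A] [Algebra R A]
    (a b : σ → A) (f : MvPolynomial σ R) {n : ℕ} (hn : f.totalDegree ≤ n) :
    (aeval (fun i ↦ Polynomial.C (a i) + Polynomial.C (b i) * Polynomial.X) f).coeff n =
      aeval b (homogeneousComponent n f) := by
  have hlin : ∀ (i : σ) (k : ℕ),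
      ((Polynomial.C (a i) + Polynomial.C (b i) * Polynomial.X) ^ k).natDegree ≤ k := fun i k ↦ by
    have h1 : (Polynomial.C (a i) + Polynomial.C (b i) * Polynomial.X).natDegree ≤ 1 := by
      rw [add_comm]
      exact Polynomial.natDegree_linear_le
    simpa using Polynomial.natDegree_pow_le_of_le k h1
  have hcoeff : ∀ (i : σ) (k : ℕ),
      ((Polynomial.C (a i) + Polynomial.C (b i) * Polynomial.X) ^ k).coeff k = b i ^ k :=
      fun i k ↦ by
    have := Polynomial.coeff_pow_of_natDegree_le (m := k) (n := 1)
      (p := Polynomial.C (a i) + Polynomial.C (b i) * Polynomial.X) (by simpa using hlin i 1)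
    simpa [Polynomial.coeff_C] using this
  have hsupp : ∀ d ∈ f.support, d.degree ≤ n := fun d hd ↦
    (le_totalDegree hd).trans hn
  rw [homogeneousComponent_apply, map_sum, Finset.sum_filter, aeval_def, eval₂_eq,
    Polynomial.finsetSum_coeff]
  refine Finset.sum_congr rfl fun d hd ↦ ?_
  rw [Polynomial.algebraMap_apply, Polynomial.coeff_C_mul]
  split_ifs with h
  · rw [aeval_monomial, ← h, Finsupp.degree_apply,
      Polynomial.coeff_prod_sum_of_natDegree_le _ _ _ fun i _ ↦ hlin i _]
    simp only [hcoeff]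
    rfl
  · rw [Polynomial.coeff_eq_zero_of_natDegree_lt, mul_zero]
    refine (Polynomial.natDegree_prod_le _ _).trans_lt ?_
    refine (Finset.sum_le_sum fun i _ ↦ hlin i _).trans_lt ?_
    exact lt_of_le_of_ne (hsupp d hd) h

/-- The shear `x ↦ x`, `y ↦ y + c x`. -/
noncomputable def shear {R : Type*} [CommRing R] (c : R) :
    MvPolynomial (Fin 2) R ≃ₐ[R] MvPolynomial (Fin 2) R :=
  AlgEquiv.ofAlgHom (aeval ![X 0, X 1 + C c * X 0]) (aeval ![X 0, X 1 - C c * X 0])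
    (by ext i : 1; fin_cases i <;> simp) (by ext i : 1; fin_cases i <;> simp)

theorem finSuccEquiv_shear {R : Type*} [CommRing R] (c : R) (f : MvPolynomial (Fin 2) R) :
    finSuccEquiv R 1 (shear c f) = aeval (fun i ↦ Polynomial.C (![0, X 0] i) +
      Polynomial.C (![1, C c] i) * Polynomial.X) f := by
  have : ((finSuccEquiv R 1).toAlgHom.comp (shear c).toAlgHom) =
      aeval (fun i ↦ Polynomial.C (![0, X 0] i) + Polynomial.C (![1, C c] i) * Polynomial.X) := by
    ext i : 1
    fin_cases i
    · simp [shear, finSuccEquiv_X_zero]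
    · have := finSuccEquiv_X_succ (R := R) (n := 1) (j := 0)
      simp [shear, finSuccEquiv_X_zero] at this ⊢
      simp [this, finSuccEquiv_apply]
  exact DFunLike.congr_fun this f

end MvPolynomial

namespace MvPolynomial

theorem homogeneousComponent_totalDegree_ne_zero {R σ : Type*} [CommSemiring R]
    {f : MvPolynomial σ R} (hf : f ≠ 0) : homogeneousComponent f.totalDegree f ≠ 0 := by
  obtain ⟨d, hd, hdeg⟩ := f.support.exists_mem_eq_sup (support_nonempty.2 hf) Finsupp.degree
  intro h
  have := congrArg (coeff d) h
  rw [coeff_homogeneousComponent, if_pos (by rw [totalDegree, hdeg.symm]; rfl), coeff_zero] at this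
  exact mem_support_iff.1 hd this

/-- Restriction to a generic line in a suitable direction: it never raises degrees, keeps the degree
of a given polynomial and turns relatively prime polynomials into coprime ones. -/
theorem exists_generic_line_restriction {K : Type*} (F L : Type*) [Field K] [Infinite K] [Field F]
    [Algebra (MvPolynomial (Fin 1) K) F] [IsFractionRing (MvPolynomial (Fin 1) K) F]
    [Field L] [Algebra F L] {q : MvPolynomial (Fin 2) K} (hq : q ≠ 0) :
    ∃ ψ : MvPolynomial (Fin 2) K →+* Polynomial L,
      Function.Injective ψ ∧ (∀ f, (ψ f).natDegree ≤ f.totalDegree) ∧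
      q.totalDegree ≤ (ψ q).natDegree ∧
      ∀ f g, g ≠ 0 → IsRelPrime f g → IsCoprime (ψ f) (ψ g) := by
  obtain ⟨c, hc⟩ := (homogeneousComponent_isHomogeneous q.totalDegree q).exists_eval_one_ne_zero
    (homogeneousComponent_totalDegree_ne_zero hq)
  let A := MvPolynomial (Fin 1) K
  let e : MvPolynomial (Fin 2) K ≃ₐ[K] Polynomial A := (shear c).trans (finSuccEquiv K 1)
  have he : ∀ f, e f = _ := finSuccEquiv_shear c
  let φ : A →+* L := (algebraMap F L).comp (algebraMap A F)
  have hφ : Function.Injective φ :=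
    (algebraMap F L).injective.comp (IsFractionRing.injective A F)
  have hψ : ∀ f, ((Polynomial.mapRingHom φ).comp e.toRingHom f) = (e f).map φ := fun f ↦ rfl
  refine ⟨(Polynomial.mapRingHom φ).comp e.toRingHom, ?_, fun f ↦ ?_, ?_, fun f g hg h ↦ ?_⟩
  · exact (Polynomial.map_injective φ hφ).comp e.injective
  · rw [hψ, Polynomial.natDegree_map_eq_of_injective hφ, he]
    refine Polynomial.natDegree_le_iff_coeff_eq_zero.2 fun n hn ↦ ?_
    rw [coeff_aeval_linear _ _ _ hn.le, homogeneousComponent_eq_zero _ _ hn, map_zero]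
  · rw [hψ, Polynomial.natDegree_map_eq_of_injective hφ]
    refine Polynomial.le_natDegree_of_ne_zero ?_
    rw [he, coeff_aeval_linear _ _ _ le_rfl]
    have : (![1, C c] : Fin 2 → A) = algebraMap K A ∘ ![1, c] := by
      ext i : 1; fin_cases i <;> simp [A, algebraMap_eq]
    rw [this, aeval_algebraMap_apply, aeval_eq_eval]
    exact (map_ne_zero_iff _ (FaithfulSMul.algebraMap_injective K A)).2 hc
  · have hef : IsRelPrime (e f) (e g) := by
      intro d hdf hdg
      have h1 := h (d := e.symm d) (by simpa using map_dvd e.symm hdf)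
        (by simpa using map_dvd e.symm hdg)
      simpa using h1.map e
    have h2 := Polynomial.isCoprime_map_of_isRelPrime F hef (by simpa using hg)
    have h3 := h2.map (Polynomial.mapRingHom (algebraMap F L))
    simpa only [hψ, Polynomial.coe_mapRingHom, Polynomial.map_map] using h3

end MvPolynomial

/-- degree bound for solutions of P(J) = V²·M (case k = 2). -/
theorem degree_bound_superelliptic_equation_k_eq_two
    (S M : MvPolynomial (Fin 2) ℚ) (hS : Squarefree S)
    (hM : ∃ n : ℕ, M ∣ S ^ n)
    (P : Polynomial ℚ) (hP : P ≠ 0)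
    (hPmult : ∀ z : ℂ, (P.map (algebraMap ℚ ℂ)).rootMultiplicity z < 2)
    (hProots : ∃ z₁ z₂ z₃ : ℂ, z₁ ≠ z₂ ∧ z₁ ≠ z₃ ∧ z₂ ≠ z₃ ∧
      Polynomial.aeval z₁ P = 0 ∧ Polynomial.aeval z₂ P = 0 ∧ Polynomial.aeval z₃ P = 0)
    (J V : FractionRing (MvPolynomial (Fin 2) ℚ))
    (hJ : ∃ (n : ℕ) (p : MvPolynomial (Fin 2) ℚ),
      (algebraMap (MvPolynomial (Fin 2) ℚ) (FractionRing (MvPolynomial (Fin 2) ℚ)) S) ^ n * J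
        = algebraMap _ _ p)
    (hV : ∃ (n : ℕ) (p : MvPolynomial (Fin 2) ℚ),
      (algebraMap (MvPolynomial (Fin 2) ℚ) (FractionRing (MvPolynomial (Fin 2) ℚ)) S) ^ n * V
        = algebraMap _ _ p)
    (heq : Polynomial.aeval J P =
      V ^ 2 * algebraMap (MvPolynomial (Fin 2) ℚ) (FractionRing (MvPolynomial (Fin 2) ℚ)) M) :
    ∀ nJ dJ : MvPolynomial (Fin 2) ℚ, dJ ≠ 0 →
      J * algebraMap _ (FractionRing (MvPolynomial (Fin 2) ℚ)) dJ = algebraMap _ _ nJ →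
      (∀ p : MvPolynomial (Fin 2) ℚ, p ∣ nJ → p ∣ dJ → IsUnit p) →
      max nJ.totalDegree dJ.totalDegree ≤ 6 * max 0 (S.totalDegree - 1) := by
  intro nJ dJ hdJ hJnd hcop
  obtain ⟨k, hMk⟩ := hM
  obtain ⟨l, p, hp⟩ := hJ
  obtain ⟨n, w, hw⟩ := hV
  obtain ⟨z₁, z₂, z₃, h12, h13, h23, h1, h2, h3⟩ := hProots
  obtain ⟨q, hq, hqmax, hqψ⟩ : ∃ q : MvPolynomial (Fin 2) ℚ, q ≠ 0 ∧
      max nJ.totalDegree dJ.totalDegree ≤ q.totalDegree ∧ (q = nJ ∨ q = dJ) := by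
    rcases le_or_gt nJ.totalDegree dJ.totalDegree with h | h
    · exact ⟨dJ, hdJ, by simp [h], .inr rfl⟩
    · exact ⟨nJ, by rintro rfl; simp at h, by simp [h.le], .inl rfl⟩
  let L := AlgebraicClosure (FractionRing (MvPolynomial (Fin 1) ℚ))
  obtain ⟨ψ, hinj, hdeg, hdegq, hψcop⟩ :=
    exists_generic_line_restriction (FractionRing (MvPolynomial (Fin 1) ℚ)) L hq
  let F := FractionRing (Polynomial L)
  have hinjF : Function.Injective ((algebraMap (Polynomial L) F).comp ψ) :=
    (IsFractionRing.injective _ _).comp hinj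
  let ι : FractionRing (MvPolynomial (Fin 2) ℚ) →+* F := IsFractionRing.lift hinjF
  have hι : ∀ f, ι (algebraMap _ _ f) = algebraMap _ F (ψ f) := fun f ↦
    IsFractionRing.lift_algebraMap hinjF f
  have key := Polynomial.max_natDegree_le_of_eval₂_eq (L := L) (F := F)
    (f := ψ nJ) (g := ψ dJ) (s := ψ S) (m := ψ M) (w := ψ w) (p := ψ p)
    (P := P.map (algebraMap ℚ L)) (J := ι J) (V := ι V) (k := k) (l := l) (n := n)
    ((Polynomial.separable_of_rootMultiplicity_lt_two hP hPmult).map)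
    (by
      rw [Polynomial.natDegree_map]
      exact Polynomial.three_le_natDegree_of_aeval_eq_zero hP h12 h13 h23 h1 h2 h3)
    ((map_ne_zero_iff ψ hinj).2 hS.ne_zero)
    (by simpa using map_dvd ψ hMk)
    (hψcop nJ dJ hdJ fun p ↦ hcop p)
    (by rw [← hι, ← hι, ← map_mul, hJnd])
    (by rw [← hι, ← hι, ← map_pow, ← map_mul, hp])
    (by rw [← hι, ← hι, ← map_pow, ← map_mul, hw])
    (by
      rw [← hι, ← map_pow, ← map_mul, ← heq, Polynomial.eval₂_map, Polynomial.aeval_def,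
        Polynomial.hom_eval₂]
      congr 1
      exact Subsingleton.elim _ _)
  have hSdeg := hdeg S
  rcases hqψ with rfl | rfl <;> omega
end

section
/- Let k ≥ 2 and n ≥ 1 be integers and let m₁,…,mₙ be integers with 1 ≤ mᵢ ≤ k−1 for all i, gcd(m₁,…,mₙ) = 1, and k dividing m₁+⋯+mₙ. Define the rational number g = (k(n−2) − ∑ᵢ gcd(k,mᵢ))/2 + 1. If g ≥ 2, then g ≥ k/12 + 1. -/
/-- A proper divisor `d` of `k` is `k / 2`, `k / 3`, or at most `k / 4`. -/
theorem proper_dvd_cases {k d : ℕ} (hk : 0 < k) (h : d ∣ k) (hlt : d < k) :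
    k = 2 * d ∨ k = 3 * d ∨ 4 * d ≤ k := by
  obtain ⟨e, rfl⟩ := h
  rcases Nat.lt_or_ge e 4 with he | he
  · interval_cases e <;> omega
  · right; right; nlinarith

set_option synthInstance.maxSize 2000 in
set_option synthInstance.maxHeartbeats 400000 in
/-- Three pairwise coprime proper divisors of a small `k`. -/
theorem small_coprime_divisors_sum_le : ∀ k < 9, ∀ a < k, ∀ b < k, ∀ c < k,
    (a ∣ k ∧ b ∣ k ∧ c ∣ k) ∧ (a.gcd b = 1 ∧ a.gcd c = 1 ∧ b.gcd c = 1) ∧ a + b + c + 2 ≤ k →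
    6 * (a + b + c) ≤ 5 * k := by
  decide +kernel

theorem coprime_divisors_sum_le_of_le {k a b c : ℕ} (ha : a ∣ k) (hb : b ∣ k) (hc : c ∣ k)
    (hak : a < k) (hab : a.Coprime b) (hac : a.Coprime c)
    (hbc : b.Coprime c) (hba : b ≤ a) (hca : c ≤ a) (h : a + b + c + 2 ≤ k) :
    6 * (a + b + c) ≤ 5 * k := by
  rcases Nat.lt_or_ge k 9 with hk | hk
  · exact small_coprime_divisors_sum_le k hk a hak b (by omega) c (by omega)
      ⟨⟨ha, hb, hc⟩, ⟨hab, hac, hbc⟩, h⟩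
  have hprod : a * (b * c) ≤ k :=
    Nat.le_of_dvd (by omega) ((hab.mul_right hac).mul_dvd_of_dvd_of_dvd ha
      (hbc.mul_dvd_of_dvd_of_dvd hb hc))
  have hb0 : 0 < b := Nat.pos_of_dvd_of_pos hb (by omega)
  have hc0 : 0 < c := Nat.pos_of_dvd_of_pos hc (by omega)
  have hbc' : b + c ≤ b * c + 1 := by nlinarith
  rcases proper_dvd_cases (by omega) ha hak with hka | hka | hka
  · have : b * c ≤ 2 := by nlinarith
    omega
  · have : b * c ≤ 3 := by nlinarith
    omega
  · omega

/-- Three pairwise coprime proper divisors of `k` whose sum is at most `k - 2`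
have sum at most `5 * k / 6`. -/
theorem coprime_divisors_sum_le {k a b c : ℕ} (ha : a ∣ k) (hb : b ∣ k) (hc : c ∣ k)
    (hak : a < k) (hbk : b < k) (hck : c < k) (hab : a.Coprime b) (hac : a.Coprime c)
    (hbc : b.Coprime c) (h : a + b + c + 2 ≤ k) :
    6 * (a + b + c) ≤ 5 * k := by
  have h₁ := coprime_divisors_sum_le_of_le ha hb hc hak hab hac hbc
  have h₂ := coprime_divisors_sum_le_of_le hb ha hc hbk hab.symm hbc hac
  have h₃ := coprime_divisors_sum_le_of_le hc ha hb hck hac.symm hbc.symm hab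
  omega

/-- If `x, y, z` have no common factor and `k` divides their sum, then the greatest common divisors
of `k` with `x` and with `y` are coprime. -/
theorem gcd_coprime_gcd_of_dvd_sum {k x y z : ℕ} (h : k ∣ x + y + z)
    (hgcd : ∀ d, d ∣ x → d ∣ y → d ∣ z → d = 1) :
    (k.gcd x).Coprime (k.gcd y) := by
  have hx := (Nat.gcd_dvd_left (k.gcd x) (k.gcd y)).trans (Nat.gcd_dvd_right k x)
  have hy := (Nat.gcd_dvd_right (k.gcd x) (k.gcd y)).trans (Nat.gcd_dvd_right k y)
  have hk := (Nat.gcd_dvd_left (k.gcd x) (k.gcd y)).trans (Nat.gcd_dvd_left k x)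
  exact hgcd _ hx hy ((Nat.dvd_add_right (hx.add hy)).1 (hk.trans h))

theorem sum_gcd_bound (k n : ℕ) (hk : 2 ≤ k) (m : Fin n → ℕ)
    (hm : ∀ i, 1 ≤ m i ∧ m i ≤ k - 1)
    (hgcd : Finset.univ.gcd m = 1) (hdvd : k ∣ ∑ i, m i)
    (h : ∑ i, k.gcd (m i) + 2 * k + 2 ≤ k * n) :
    6 * ∑ i, k.gcd (m i) + 13 * k ≤ 6 * (k * n) := by
  have hd : ∀ i, k.gcd (m i) ∣ k := fun i => Nat.gcd_dvd_left _ _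
  have hlt : ∀ i, k.gcd (m i) < k := fun i => by
    have := Nat.gcd_le_right k (hm i).1
    have := hm i
    omega
  have hcases := fun i => proper_dvd_cases (by omega) (hd i) (hlt i)
  rcases Nat.lt_or_ge n 5 with hn | hn
  · interval_cases n
    · omega
    · omega
    · omega
    · have hcommon : ∀ d, d ∣ m 0 → d ∣ m 1 → d ∣ m 2 → d = 1 := fun d h0 h1 h2 => by
        rw [← Nat.dvd_one, ← hgcd]
        refine Finset.dvd_gcd fun i _ => ?_
        fin_cases i <;> assumption
      simp only [Fin.sum_univ_three] at *
      have := coprime_divisors_sum_le (hd 0) (hd 1) (hd 2) (hlt 0) (hlt 1) (hlt 2)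
        (gcd_coprime_gcd_of_dvd_sum hdvd hcommon)
        (gcd_coprime_gcd_of_dvd_sum (z := m 1) (by convert hdvd using 1; ring)
          fun d h0 h2 h1 => hcommon d h0 h1 h2)
        (gcd_coprime_gcd_of_dvd_sum (z := m 0) (by convert hdvd using 1; ring)
          fun d h1 h2 h0 => hcommon d h0 h1 h2)
        (by omega)
      omega
    · simp only [Fin.sum_univ_four] at *
      have h0 := hcases 0
      have h1 := hcases 1
      have h2 := hcases 2
      have h3 := hcases 3
      omega
  · have hS : 2 * ∑ i, k.gcd (m i) ≤ n * k := by
      rw [Finset.mul_sum]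
      refine (Finset.sum_le_card_nsmul _ _ k fun i _ => ?_).trans (by simp)
      have := hcases i
      omega
    nlinarith

/-- genus lower bound for superelliptic curves of genus ≥ 2. -/
theorem superelliptic_genus_ge_two_bound
    (k n : ℕ) (hk : 2 ≤ k) (hn : 1 ≤ n) (m : Fin n → ℕ)
    (hm : ∀ i, 1 ≤ m i ∧ m i ≤ k - 1)
    (hgcd : Finset.univ.gcd m = 1)
    (hdvd : k ∣ ∑ i, m i)
    (g : ℚ)
    (hg : g = ((k : ℚ) * ((n : ℚ) - 2) - ∑ i, (Nat.gcd k (m i) : ℚ)) / 2 + 1)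
    (hg2 : 2 ≤ g) :
    (k : ℚ) / 12 + 1 ≤ g := by
  have h : ∑ i, k.gcd (m i) + 2 * k + 2 ≤ k * n := by
    have : ((∑ i, k.gcd (m i) + 2 * k + 2 : ℕ) : ℚ) ≤ (k * n : ℕ) := by
      push_cast
      linarith
    exact_mod_cast this
  have hbound : ((6 * ∑ i, k.gcd (m i) + 13 * k : ℕ) : ℚ) ≤ (6 * (k * n) : ℕ) :=
    Nat.cast_le.2 (sum_gcd_bound k n hk m hm hgcd hdvd h)
  push_cast at hbound
  linarith
end

section
/- Let k ≥ 2 and n ≥ 1 be integers and let m₁,…,mₙ be integers with 1 ≤ mᵢ ≤ k−1 for all i, gcd(m₁,…,mₙ) = 1, and k dividing m₁+⋯+mₙ. Define g = (k(n−2) − ∑ᵢ gcd(k,mᵢ))/2 + 1. If g = 0, then n ≤ 2. -/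
theorem two_mul_gcd_le_of_lt {k m : ℕ} (hm : 0 < m) (hmk : m < k) : 2 * Nat.gcd k m ≤ k := by
  obtain ⟨c, hc⟩ := Nat.gcd_dvd_left k m
  have hle : Nat.gcd k m ≤ m := Nat.gcd_le_right k hm
  have hc2 : 2 ≤ c := by
    by_contra! h
    interval_cases c <;> omega
  calc 2 * Nat.gcd k m = Nat.gcd k m * 2 := mul_comm _ _
    _ ≤ Nat.gcd k m * c := Nat.mul_le_mul_left _ hc2
    _ = k := hc.symm

theorem coprime_gcd_gcd_of_dvd_add {k a b c : ℕ} (habc : k ∣ a + b + c)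
    (h : ∀ d, d ∣ a → d ∣ b → d ∣ c → d = 1) :
    Nat.Coprime (Nat.gcd k a) (Nat.gcd k b) := by
  have hk : Nat.gcd (Nat.gcd k a) (Nat.gcd k b) ∣ k :=
    (Nat.gcd_dvd_left _ _).trans (Nat.gcd_dvd_left _ _)
  have ha : Nat.gcd (Nat.gcd k a) (Nat.gcd k b) ∣ a :=
    (Nat.gcd_dvd_left _ _).trans (Nat.gcd_dvd_right _ _)
  have hb : Nat.gcd (Nat.gcd k a) (Nat.gcd k b) ∣ b :=
    (Nat.gcd_dvd_right _ _).trans (Nat.gcd_dvd_right _ _)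
  exact h _ ha hb ((Nat.dvd_add_right (ha.add hb)).mp (hk.trans habc))

theorem add_add_ne_add_two_of_mul_le {a b c k : ℕ} (ha : 0 < a) (hb : 0 < b) (hc : 0 < c)
    (hak : a < k) (hbk : b < k) (hck : c < k) (h : a * b * c ≤ k) :
    a + b + c ≠ k + 2 := by
  intro hs
  obtain ⟨x, rfl⟩ := Nat.exists_eq_add_of_lt ha
  obtain ⟨y, rfl⟩ := Nat.exists_eq_add_of_lt hb
  obtain ⟨z, rfl⟩ := Nat.exists_eq_add_of_lt hc
  have hxyz : x * y + y * z + x * z + x * y * z ≤ 0 := by nlinarith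
  have hxy : x * y = 0 := by omega
  have hyz : y * z = 0 := by omega
  have hxz : x * z = 0 := by omega
  rw [mul_eq_zero] at hxy hyz hxz
  omega

/-- a superelliptic curve of genus 0 has at most two branch points. -/
theorem superelliptic_genus_zero_branch_points
    (k n : ℕ) (hk : 2 ≤ k) (hn : 1 ≤ n) (m : Fin n → ℕ)
    (hm : ∀ i, 1 ≤ m i ∧ m i ≤ k - 1)
    (hgcd : Finset.univ.gcd m = 1)
    (hdvd : k ∣ ∑ i, m i)
    (g : ℚ)
    (hg : g = ((k : ℚ) * ((n : ℚ) - 2) - ∑ i, (Nat.gcd k (m i) : ℚ)) / 2 + 1)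
    (hg0 : g = 0) :
    n ≤ 2 := by
  have hlt : ∀ i, m i < k := fun i => by have := hm i; omega
  have hpos : ∀ i, 0 < Nat.gcd k (m i) := fun i => Nat.gcd_pos_of_pos_left _ (by omega)
  have hsum : k * n + 2 = ∑ i, Nat.gcd k (m i) + 2 * k := by
    have : (k : ℚ) * n + 2 = ∑ i, (Nat.gcd k (m i) : ℚ) + 2 * k := by linarith
    exact_mod_cast this
  have hbound : 2 * ∑ i, Nat.gcd k (m i) ≤ n * k := by
    rw [Finset.mul_sum]
    simpa using Finset.sum_le_card_nsmul Finset.univ (fun i => 2 * Nat.gcd k (m i)) k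
      fun i _ => two_mul_gcd_le_of_lt (hm i).1 (hlt i)
  by_contra! hn2
  have hn3 : n = 3 := by
    by_contra hne
    have hn4 : 4 ≤ n := by omega
    nlinarith [Nat.mul_le_mul_right k hn4]
  subst hn3
  rw [Fin.sum_univ_three] at hsum hdvd
  have hone : ∀ d, d ∣ m 0 → d ∣ m 1 → d ∣ m 2 → d = 1 := fun d h0 h1 h2 => by
    rw [← Nat.dvd_one, ← hgcd]
    refine Finset.dvd_gcd fun i _ => ?_
    fin_cases i <;> assumption
  have h01 := coprime_gcd_gcd_of_dvd_add hdvd hone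
  have h02 : Nat.Coprime (Nat.gcd k (m 0)) (Nat.gcd k (m 2)) :=
    coprime_gcd_gcd_of_dvd_add (c := m 1) (by rwa [add_right_comm])
      fun d h0 h2 h1 => hone d h0 h1 h2
  have h12 : Nat.Coprime (Nat.gcd k (m 1)) (Nat.gcd k (m 2)) :=
    coprime_gcd_gcd_of_dvd_add (c := m 0) (by rwa [add_comm, ← add_assoc])
      fun d h1 h2 h0 => hone d h0 h1 h2
  have hprod : Nat.gcd k (m 0) * Nat.gcd k (m 1) * Nat.gcd k (m 2) ∣ k :=
    (h02.mul_left h12).mul_dvd_of_dvd_of_dvd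
      (h01.mul_dvd_of_dvd_of_dvd (Nat.gcd_dvd_left _ _) (Nat.gcd_dvd_left _ _))
      (Nat.gcd_dvd_left _ _)
  have hgk : ∀ i, Nat.gcd k (m i) < k := fun i =>
    (Nat.gcd_le_right k (hm i).1).trans_lt (hlt i)
  exact add_add_ne_add_two_of_mul_le (hpos 0) (hpos 1) (hpos 2) (hgk 0) (hgk 1) (hgk 2)
    (Nat.le_of_dvd (by omega) hprod) (by omega)
end

section
/- Let k ≥ 2 be an integer and let m₁,m₂,m₃ be integers with 1 ≤ mᵢ ≤ k−1 for all i, gcd(m₁,m₂,m₃) = 1, and k dividing m₁+m₂+m₃. Define g = (k − ∑ᵢ gcd(k,mᵢ))/2 + 1. If g ≤ 1, then one of the following holds: k = 3 and gcd(3,mᵢ) = 1 for all i; or k = 4 and the multiset {gcd(4,m₁), gcd(4,m₂), gcd(4,m₃)} equals {2,1,1}; or k = 6 and the multiset {gcd(6,m₁), gcd(6,m₂), gcd(6,m₃)} equals {3,2,1}. -/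
/-- If `k` is at most the sum of three pairwise coprime divisors, the first of which is the largest
and smaller than `k`, then `k ≤ 6`. -/
lemma le_six_of_le_add_of_coprime_of_max {k a b c : ℕ} (hk : 0 < k)
    (ha : a ∣ k) (hb : b ∣ k) (hc : c ∣ k)
    (hab : a.Coprime b) (hac : a.Coprime c) (hbc : b.Coprime c)
    (hak : a < k) (hba : b ≤ a) (hca : c ≤ a) (hsum : k ≤ a + b + c) : k ≤ 6 := by
  obtain ⟨t, ht⟩ : a * (b * c) ∣ k :=
    (hab.mul_right hac).mul_dvd_of_dvd_of_dvd ha (hbc.mul_dvd_of_dvd_of_dvd hb hc)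
  have hs : k = a * (b * c * t) := by rw [ht, mul_assoc]
  have ha0 : 0 < a := Nat.pos_of_dvd_of_pos ha hk
  have hb0 : 0 < b := Nat.pos_of_dvd_of_pos hb hk
  have hc0 : 0 < c := Nat.pos_of_dvd_of_pos hc hk
  have hbcs : b * c ∣ b * c * t := Dvd.intro t rfl
  generalize b * c * t = s at hs hbcs
  have hs3 : s ≤ 3 := by
    by_contra! h
    nlinarith
  have hs2 : 2 ≤ s := by
    by_contra! h
    nlinarith
  have hle : b * c ≤ s := Nat.le_of_dvd (by omega) hbcs
  have hsum' : b + c ≤ s + 1 := by nlinarith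
  interval_cases s <;> omega

/-- If `k` is at most the sum of three pairwise coprime proper divisors, then `k ≤ 6`. -/
lemma le_six_of_le_add_of_coprime {k a b c : ℕ} (hk : 0 < k)
    (ha : a ∣ k) (hb : b ∣ k) (hc : c ∣ k)
    (hab : a.Coprime b) (hac : a.Coprime c) (hbc : b.Coprime c)
    (hak : a < k) (hbk : b < k) (hck : c < k) (hsum : k ≤ a + b + c) : k ≤ 6 := by
  rcases le_total a b with h₁ | h₁ <;> rcases le_total b c with h₂ | h₂ <;>
    rcases le_total a c with h₃ | h₃
  all_goals first
    | exact le_six_of_le_add_of_coprime_of_max hk ha hb hc hab hac hbc hak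
        (by omega) (by omega) hsum
    | exact le_six_of_le_add_of_coprime_of_max hk hb ha hc hab.symm hbc hac hbk
        (by omega) (by omega) (by omega)
    | exact le_six_of_le_add_of_coprime_of_max hk hc ha hb hac.symm hbc.symm hab hck
        (by omega) (by omega) (by omega)

/-- If `k` divides `x + y + z` and `x, y, z` have no common factor, then the greatest common
divisors of `k` with `x` and with `y` are coprime. -/
lemma coprime_gcd_gcd_of_dvd_add_s6 {k x y z : ℕ} (hdvd : k ∣ x + y + z)
    (hgcd : Nat.gcd x (Nat.gcd y z) = 1) : (Nat.gcd k x).Coprime (Nat.gcd k y) := by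
  set d := Nat.gcd (Nat.gcd k x) (Nat.gcd k y) with hd
  have hk : d ∣ k := (Nat.gcd_dvd_left _ _).trans (Nat.gcd_dvd_left _ _)
  have hx : d ∣ x := (Nat.gcd_dvd_left _ _).trans (Nat.gcd_dvd_right _ _)
  have hy : d ∣ y := (Nat.gcd_dvd_right _ _).trans (Nat.gcd_dvd_right _ _)
  have hz : d ∣ z := (Nat.dvd_add_right (hx.add hy)).mp (hk.trans hdvd)
  exact Nat.dvd_one.mp (hgcd ▸ Nat.dvd_gcd hx (Nat.dvd_gcd hy hz))

/-- The greatest common divisors that occur when `k ≤ 6`. -/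
lemma gcd_classification_of_lt_seven : ∀ (k : Fin 7) (x y z : Fin k.val),
    (2 ≤ k.val ∧ 1 ≤ x.val ∧ 1 ≤ y.val ∧ 1 ≤ z.val ∧ Nat.gcd x (Nat.gcd y z) = 1 ∧
      k.val ∣ x.val + y + z ∧ k.val ≤ Nat.gcd k x + Nat.gcd k y + Nat.gcd k z) →
    (k.val = 3 ∧ Nat.gcd 3 x = 1 ∧ Nat.gcd 3 y = 1 ∧ Nat.gcd 3 z = 1) ∨
    (k.val = 4 ∧ ({Nat.gcd 4 x, Nat.gcd 4 y, Nat.gcd 4 z} : Multiset ℕ) = {2, 1, 1}) ∨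
    (k.val = 6 ∧ ({Nat.gcd 6 x, Nat.gcd 6 y, Nat.gcd 6 z} : Multiset ℕ) = {3, 2, 1}) := by
  decide +kernel

/-- classification of superelliptic curves with three branch points
and genus at most 1. -/
theorem superelliptic_three_branch_points_genus_le_one
    (k : ℕ) (hk : 2 ≤ k) (m : Fin 3 → ℕ)
    (hm : ∀ i, 1 ≤ m i ∧ m i ≤ k - 1)
    (hgcd : Finset.univ.gcd m = 1)
    (hdvd : k ∣ ∑ i, m i)
    (g : ℚ)
    (hg : g = ((k : ℚ) - ∑ i, (Nat.gcd k (m i) : ℚ)) / 2 + 1)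
    (hg1 : g ≤ 1) :
    (k = 3 ∧ ∀ i, Nat.gcd 3 (m i) = 1) ∨
    (k = 4 ∧ ({Nat.gcd 4 (m 0), Nat.gcd 4 (m 1), Nat.gcd 4 (m 2)} : Multiset ℕ) = {2, 1, 1}) ∨
    (k = 6 ∧ ({Nat.gcd 6 (m 0), Nat.gcd 6 (m 1), Nat.gcd 6 (m 2)} : Multiset ℕ) = {3, 2, 1}) := by
  rw [Fin.sum_univ_three] at hdvd hg
  have hsum : k ≤ Nat.gcd k (m 0) + Nat.gcd k (m 1) + Nat.gcd k (m 2) := by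
    have : (k : ℚ) ≤ Nat.gcd k (m 0) + Nat.gcd k (m 1) + Nat.gcd k (m 2) := by linarith
    exact_mod_cast this
  have hgcd' : Nat.gcd (m 0) (Nat.gcd (m 1) (m 2)) = 1 := by
    rw [← Nat.dvd_one, ← hgcd]
    refine Finset.dvd_gcd fun i _ => ?_
    fin_cases i
    · exact Nat.gcd_dvd_left _ _
    · exact (Nat.gcd_dvd_right _ _).trans (Nat.gcd_dvd_left _ _)
    · exact (Nat.gcd_dvd_right _ _).trans (Nat.gcd_dvd_right _ _)
  have hlt (i : Fin 3) : m i < k := by have := hm i; omega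
  have hglt (i : Fin 3) : Nat.gcd k (m i) < k :=
    (Nat.gcd_le_right _ (hm i).1).trans_lt (hlt i)
  have h01 := coprime_gcd_gcd_of_dvd_add_s6 hdvd hgcd'
  have h02 : (Nat.gcd k (m 0)).Coprime (Nat.gcd k (m 2)) :=
    coprime_gcd_gcd_of_dvd_add_s6 (z := m 1) (by rwa [add_right_comm])
      (by rwa [Nat.gcd_comm (m 2)])
  have h12 : (Nat.gcd k (m 1)).Coprime (Nat.gcd k (m 2)) :=
    coprime_gcd_gcd_of_dvd_add_s6 (z := m 0) (by rwa [add_comm, ← add_assoc])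
      (by rwa [← Nat.gcd_assoc, Nat.gcd_comm])
  have hk6 : k ≤ 6 := le_six_of_le_add_of_coprime (by omega) (Nat.gcd_dvd_left _ _)
    (Nat.gcd_dvd_left _ _) (Nat.gcd_dvd_left _ _) h01 h02 h12 (hglt 0) (hglt 1) (hglt 2) hsum
  refine (gcd_classification_of_lt_seven ⟨k, by omega⟩ ⟨_, hlt 0⟩ ⟨_, hlt 1⟩ ⟨_, hlt 2⟩
    ⟨hk, (hm 0).1, (hm 1).1, (hm 2).1, hgcd', hdvd, hsum⟩).imp_left fun ⟨h3, h⟩ => ⟨h3, ?_⟩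
  simpa [Fin.forall_fin_succ] using h
end

section
/- Let K be a field and let s, p, q ∈ K with p² ≠ s and q² ≠ s. Define the 2×2 matrices over K: A = [[1,0],[0,−1]], B = [[−(p²+s)/(p²−s), −2sp/(p²−s)],[2p/(p²−s), (p²+s)/(p²−s)]], and C = [[−(q²+s)/(q²−s), −2sq/(q²−s)],[2q/(q²−s), (q²+s)/(q²−s)]]. Then A² = B² = C² = I (the identity matrix), and the three products A·B, A·C, B·C pairwise commute: (AB)(AC) = (AC)(AB), (AB)(BC) = (BC)(AB), and (AC)(BC) = (BC)(AC). -/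
/-- The trace-zero matrix with entries `-u`, `-s v`, `v`, `u`. Up to the diagonal matrix with
entries `1`, `-1` it is multiplication by `-(u + v √s)` on `K[√s]`. -/
def twistedMul {K : Type*} [CommRing K] (s u v : K) : Matrix (Fin 2) (Fin 2) K :=
  !![-u, -(s * v); v, u]

theorem twistedMul_mul_self {K : Type*} [CommRing K] {s u v : K} (h : u ^ 2 - s * v ^ 2 = 1) :
    twistedMul s u v * twistedMul s u v = 1 := by
  ext i j
  fin_cases i <;> fin_cases j <;> simp [twistedMul, Matrix.mul_apply] <;>
    first | linear_combination h | ring1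

theorem norm_rational_parametrization {K : Type*} [Field K] {s p : K} (hp : p ^ 2 ≠ s) :
    ((p ^ 2 + s) / (p ^ 2 - s)) ^ 2 - s * (2 * p / (p ^ 2 - s)) ^ 2 = 1 := by
  have := sub_ne_zero.mpr hp
  field_simp
  ring

theorem eq_twistedMul {K : Type*} [Field K] (s p : K) :
    !![-(p ^ 2 + s) / (p ^ 2 - s), -(2 * s * p) / (p ^ 2 - s);
       2 * p / (p ^ 2 - s), (p ^ 2 + s) / (p ^ 2 - s)] =
      twistedMul s ((p ^ 2 + s) / (p ^ 2 - s)) (2 * p / (p ^ 2 - s)) := by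
  ext i j
  fin_cases i <;> fin_cases j <;> simp [twistedMul] <;> ring

/-- the three monodromy matrices of the Heun equation with half-integer
exponent differences are involutions whose pairwise products commute. -/
theorem heun_monodromy_involutions_commute
    (K : Type*) [Field K] (s p q : K) (hp : p ^ 2 ≠ s) (hq : q ^ 2 ≠ s)
    (A B C : Matrix (Fin 2) (Fin 2) K)
    (hA : A = !![1, 0; 0, -1])
    (hB : B = !![-(p ^ 2 + s) / (p ^ 2 - s), -(2 * s * p) / (p ^ 2 - s);
                 2 * p / (p ^ 2 - s), (p ^ 2 + s) / (p ^ 2 - s)])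
    (hC : C = !![-(q ^ 2 + s) / (q ^ 2 - s), -(2 * s * q) / (q ^ 2 - s);
                 2 * q / (q ^ 2 - s), (q ^ 2 + s) / (q ^ 2 - s)]) :
    A * A = 1 ∧ B * B = 1 ∧ C * C = 1 ∧
    (A * B) * (A * C) = (A * C) * (A * B) ∧
    (A * B) * (B * C) = (B * C) * (A * B) ∧
    (A * C) * (B * C) = (B * C) * (A * C) := by
  rw [eq_twistedMul] at hB hC
  subst hA hB hC
  refine ⟨?_, twistedMul_mul_self (norm_rational_parametrization hp),
    twistedMul_mul_self (norm_rational_parametrization hq), ?_, ?_, ?_⟩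
  · simp [Matrix.one_fin_two]
  all_goals
    generalize (p ^ 2 + s) / (p ^ 2 - s) = u, 2 * p / (p ^ 2 - s) = v,
      (q ^ 2 + s) / (q ^ 2 - s) = w, 2 * q / (q ^ 2 - s) = x
    simp only [twistedMul, Matrix.mul_fin_two]
    congr! 3 <;> ring_nf
end

section
/- Let p₂, p₃, q₂, q₃ ∈ ℂ with p₃ ≠ 0 and q₃ ≠ 0. Define the 2×2 complex matrices A = [[1,0],[0,−1]], B = [[2p₂p₃+1, 2(p₂p₃+1)p₂],[−2p₃, −2p₂p₃−1]], and C = [[2q₂q₃+1, 2(q₂q₃+1)q₂],[−2q₃, −2q₂q₃−1]]. Then det B = det C = −1, trace B = trace C = 0, det(A·B·C) = −1, and trace(A·B·C) = 0 if and only if p₂² + p₂/p₃ = q₂² + q₂/q₃. In particular, A·B·C has eigenvalues 1 and −1 if and only if p₂² + p₂/p₃ = q₂² + q₂/q₃. -/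
open Matrix in
/-- A `2 × 2` matrix of determinant `-1` fixes a nonzero vector exactly when its trace is `0`. -/
theorem Matrix.exists_mulVec_eq_self_iff_trace_eq_zero {K : Type*} [Field K]
    {M : Matrix (Fin 2) (Fin 2) K} (hM : M.det = -1) :
    (∃ v, v ≠ 0 ∧ M *ᵥ v = v) ↔ M.trace = 0 := by
  have hdet : (M - 1).det = -M.trace := by
    rw [det_fin_two] at hM
    simp [det_fin_two, trace_fin_two]
    linear_combination hM
  rw [← neg_eq_zero, ← hdet, ← exists_mulVec_eq_zero_iff]
  simp only [sub_mulVec, one_mulVec, sub_eq_zero]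

open Matrix in
/-- A `2 × 2` matrix of determinant `-1` negates a nonzero vector exactly when its trace is `0`. -/
theorem Matrix.exists_mulVec_eq_neg_iff_trace_eq_zero {K : Type*} [Field K]
    {M : Matrix (Fin 2) (Fin 2) K} (hM : M.det = -1) :
    (∃ v, v ≠ 0 ∧ M *ᵥ v = -v) ↔ M.trace = 0 := by
  have hneg : (-M).det = -1 := by rw [det_neg, hM]; simp
  simpa only [neg_mulVec, neg_eq_iff_eq_neg, trace_neg, neg_eq_zero, neg_zero] using
    exists_mulVec_eq_self_iff_trace_eq_zero hneg


/-- the product of the three parametrized monodromy matrices has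
eigenvalues 1 and -1 exactly when p₂² + p₂/p₃ = q₂² + q₂/q₃. -/
theorem heun_monodromy_product_eigenvalues
    (p₂ p₃ q₂ q₃ : ℂ) (hp₃ : p₃ ≠ 0) (hq₃ : q₃ ≠ 0)
    (A B C : Matrix (Fin 2) (Fin 2) ℂ)
    (hA : A = !![1, 0; 0, -1])
    (hB : B = !![2 * p₂ * p₃ + 1, 2 * (p₂ * p₃ + 1) * p₂; -2 * p₃, -2 * p₂ * p₃ - 1])
    (hC : C = !![2 * q₂ * q₃ + 1, 2 * (q₂ * q₃ + 1) * q₂; -2 * q₃, -2 * q₂ * q₃ - 1]) :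
    B.det = -1 ∧ C.det = -1 ∧ B.trace = 0 ∧ C.trace = 0 ∧ (A * B * C).det = -1 ∧
    ((A * B * C).trace = 0 ↔ p₂ ^ 2 + p₂ / p₃ = q₂ ^ 2 + q₂ / q₃) ∧
    (((∃ v : Fin 2 → ℂ, v ≠ 0 ∧ (A * B * C).mulVec v = v) ∧
      (∃ w : Fin 2 → ℂ, w ≠ 0 ∧ (A * B * C).mulVec w = -w)) ↔
      p₂ ^ 2 + p₂ / p₃ = q₂ ^ 2 + q₂ / q₃) := by
  have hdetA : A.det = -1 := by simp [hA]
  have hdetB : B.det = -1 := by rw [hB, Matrix.det_fin_two_of]; ring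
  have hdetC : C.det = -1 := by rw [hC, Matrix.det_fin_two_of]; ring
  have hdet : (A * B * C).det = -1 := by
    rw [Matrix.det_mul, Matrix.det_mul, hdetA, hdetB, hdetC]; norm_num
  have htrace : (A * B * C).trace =
      4 * p₃ * q₃ * ((q₂ ^ 2 + q₂ / q₃) - (p₂ ^ 2 + p₂ / p₃)) := by
    simp [hA, hB, hC, Matrix.trace_fin_two]
    field_simp
    ring
  have hiff : (A * B * C).trace = 0 ↔ p₂ ^ 2 + p₂ / p₃ = q₂ ^ 2 + q₂ / q₃ := by
    rw [htrace, mul_eq_zero_iff_left (by simp [hp₃, hq₃]), sub_eq_zero, eq_comm]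
  refine ⟨hdetB, hdetC, ?_, ?_, hdet, hiff, ?_⟩
  · rw [hB, Matrix.trace_fin_two_of]; ring
  · rw [hC, Matrix.trace_fin_two_of]; ring
  · rw [Matrix.exists_mulVec_eq_self_iff_trace_eq_zero hdet,
      Matrix.exists_mulVec_eq_neg_iff_trace_eq_zero hdet, and_self, hiff]
end

section
/- Let λ ∈ ℂ be a nonzero algebraic number over ℚ. If for every complex root μ of the minimal polynomial of λ over ℚ the ratio μ/λ is a rational number, then λ² ∈ ℚ. -/
/-- If a rational multiple `q * x` of a nonzero integral element `x` is a conjugate of `x`,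
then `q` is a root of unity. -/
theorem pow_natDegree_minpoly_eq_one_of_conjugate_mul {K L : Type*} [Field K] [Field L]
    [Algebra K L] {x : L} (hx : x ≠ 0) (hint : IsIntegral K x) {q : K}
    (hq : Polynomial.aeval (algebraMap K L q * x) (minpoly K x) = 0) :
    q ^ (minpoly K x).natDegree = 1 := by
  have hmonic := minpoly.monic hint
  have hroot : Polynomial.aeval (algebraMap K L q * x) ((minpoly K x).scaleRoots q) = 0 :=
    Polynomial.scaleRoots_aeval_eq_zero (minpoly.aeval K x)
  have hmin : minpoly K x = minpoly K (algebraMap K L q * x) :=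
    minpoly.eq_of_irreducible_of_monic (minpoly.irreducible hint) hq hmonic
  have hdvd : minpoly K x ∣ (minpoly K x).scaleRoots q := by
    have := minpoly.dvd K _ hroot
    rwa [← hmin] at this
  have heq : (minpoly K x).scaleRoots q = minpoly K x :=
    Polynomial.eq_of_monic_of_dvd_of_natDegree_le hmonic
      ((Polynomial.monic_scaleRoots_iff q).2 hmonic) hdvd (Polynomial.natDegree_scaleRoots _ _).le
  have hcoeff := congrArg (Polynomial.coeff · 0) heq
  simp only [Polynomial.coeff_scaleRoots, Nat.sub_zero] at hcoeff
  exact mul_left_cancel₀ (minpoly.coeff_zero_ne_zero hint hx) (hcoeff.trans (mul_one _).symm)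

/-- if all Galois conjugates of a nonzero algebraic number λ are rational
multiples of λ, then λ² is rational. -/
theorem conjugates_rational_ratio_sq_rational
    (lam : ℂ) (hlam : lam ≠ 0) (halg : IsAlgebraic ℚ lam)
    (hconj : ∀ μ : ℂ, Polynomial.aeval μ (minpoly ℚ lam) = 0 → ∃ q : ℚ, μ = (q : ℂ) * lam) :
    ∃ q : ℚ, lam ^ 2 = (q : ℂ) := by
  have hint : IsIntegral ℚ lam := halg.isIntegral
  have hpos := minpoly.natDegree_pos hint
  have hroots : ∀ μ : ℂ, Polynomial.aeval μ (minpoly ℚ lam) = 0 → μ = lam ∨ μ = -lam := by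
    intro μ hμ
    obtain ⟨q, rfl⟩ := hconj μ hμ
    have hpow := pow_natDegree_minpoly_eq_one_of_conjugate_mul hlam hint (q := q) (by simpa using hμ)
    have habs : |q| = 1 :=
      (pow_eq_one_iff_of_nonneg (abs_nonneg q) hpos.ne').1 (by rw [← abs_pow, hpow, abs_one])
    rcases eq_or_eq_neg_of_abs_eq habs with rfl | rfl <;> simp
  have hcard : ((minpoly ℚ lam).rootSet ℂ).ncard = (minpoly ℚ lam).natDegree := by
    rw [← Nat.card_coe_set_eq, Nat.card_eq_fintype_card]
    exact Polynomial.card_rootSet_eq_natDegree (minpoly.irreducible hint).separable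
      (IsAlgClosed.splits _)
  have hsub : (minpoly ℚ lam).rootSet ℂ ⊆ {lam, -lam} := fun μ hμ =>
    hroots μ (Polynomial.aeval_eq_zero_of_mem_rootSet hμ)
  by_cases hneg : Polynomial.aeval (-lam) (minpoly ℚ lam) = 0
  · have hle : (minpoly ℚ lam).natDegree ≤ 2 :=
      hcard ▸ (Set.ncard_le_ncard hsub).trans (Set.ncard_pair (self_ne_neg.2 hlam)).le
    have hge : 2 ≤ (minpoly ℚ lam).natDegree := by
      rw [← hcard, ← Set.ncard_pair (self_ne_neg.2 hlam)]
      refine Set.ncard_le_ncard ?_ (Polynomial.rootSet_finite _ _)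
      rintro μ (rfl | rfl)
      · exact (Polynomial.mem_rootSet_of_ne (minpoly.ne_zero hint)).2 (minpoly.aeval ℚ μ)
      · exact (Polynomial.mem_rootSet_of_ne (minpoly.ne_zero hint)).2 hneg
    have hdeg := le_antisymm hle hge
    have hlead : (minpoly ℚ lam).coeff 2 = 1 := hdeg ▸ minpoly.monic hint
    have hpl := minpoly.aeval ℚ lam
    rw [Polynomial.aeval_eq_sum_range, hdeg] at hpl hneg
    simp only [Finset.sum_range_succ, Finset.sum_range_zero, hlead, Algebra.smul_def,
      eq_ratCast, Rat.cast_one] at hpl hneg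
    refine ⟨-(minpoly ℚ lam).coeff 0, ?_⟩
    push_cast
    linear_combination (hpl + hneg) / 2
  · have hle : (minpoly ℚ lam).natDegree ≤ 1 := by
      rw [← hcard, ← Set.ncard_singleton lam]
      refine Set.ncard_le_ncard fun μ hμ => (hsub hμ).resolve_right ?_
      rintro rfl
      exact hneg (Polynomial.aeval_eq_zero_of_mem_rootSet hμ)
    obtain ⟨r, hr⟩ := minpoly.natDegree_eq_one_iff.1 (le_antisymm hle hpos)
    exact ⟨r ^ 2, by rw [← hr]; simp⟩
end

section
/- Let U ⊆ ℂ be a nonempty open connected set, h ∈ ℂ, and let f be analytic on U with f'(z) ≠ 0 for all z ∈ U and with constant Schwarzian derivative S(f) = f'''/f' − (3/2)(f''/f')² = h on U. Then there exist a, b, c, d ∈ ℂ with ad − bc ≠ 0 such that: if h = 0, then f(z) = (az + b)/(cz + d) for all z ∈ U; and if h ≠ 0, then there exists μ ∈ ℂ with μ² = −2h such that f(z) = (a·e^{μz} + b)/(c·e^{μz} + d) for all z ∈ U. -/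
/-- Two solutions of `G' = q G` on a connected open set on which `φ' = 2 q φ` has a nonvanishing
solution are proportional as soon as one of them is nonzero somewhere, and that one has no zero. -/
lemma proportional_of_linear_ode {U : Set ℂ} (hU : IsOpen U) (hUc : IsPreconnected U)
    {φ q G H : ℂ → ℂ} (hφ : ∀ z ∈ U, HasDerivAt φ (2 * q z * φ z) z) (hφ0 : ∀ z ∈ U, φ z ≠ 0)
    (hG : ∀ z ∈ U, HasDerivAt G (q z * G z) z) (hH : ∀ z ∈ U, HasDerivAt H (q z * H z) z)
    {z₀ : ℂ} (hz₀ : z₀ ∈ U) (hH0 : H z₀ ≠ 0) {z : ℂ} (hz : z ∈ U) :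
    H z ≠ 0 ∧ G z = H z / H z₀ * G z₀ := by
  have key : ∀ K : ℂ → ℂ, (∀ w ∈ U, HasDerivAt K (q w * K w) w) →
      K z * H z / φ z = K z₀ * H z₀ / φ z₀ := by
    intro K hK
    have hd : ∀ w ∈ U, HasDerivAt (fun w => K w * H w / φ w) 0 w := by
      intro w hw
      have hw0 := hφ0 w hw
      refine (((hK w hw).mul (hH w hw)).div (hφ w hw) hw0).congr_deriv ?_
      simp only [Pi.mul_apply]
      field_simp
      ring
    exact hU.is_const_of_deriv_eq_zero hUc
      (fun w hw => (hd w hw).differentiableAt.differentiableWithinAt)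
      (fun w hw => (hd w hw).deriv) hz hz₀
  have hφz := hφ0 z hz
  have hφz₀ := hφ0 z₀ hz₀
  have hHz : H z ≠ 0 := by
    intro h0
    have h1 := key H hH
    rw [h0, zero_mul, zero_div] at h1
    exact div_ne_zero (mul_ne_zero hH0 hH0) hφz₀ h1.symm
  refine ⟨hHz, ?_⟩
  have h1 := key H hH
  have h2 := key G hG
  have h3 : (H z * H z / φ z) * (G z * H z₀ - H z * G z₀) = 0 := by
    calc _ = H z * (G z * H z / φ z * H z₀ - H z * H z / φ z * G z₀) := by ring
      _ = 0 := by rw [h2, h1]; ring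
  have h4 : G z * H z₀ - H z * G z₀ = 0 :=
    (mul_eq_zero.mp h3).resolve_left (div_ne_zero (mul_ne_zero hHz hHz) hφz)
  field_simp
  linear_combination h4

/-- If the entries of a nonsingular matrix function all solve `G' = q G`, then the Moebius
transformation it induces does not depend on the point. -/
lemma exists_moebius_of_linear_ode {U : Set ℂ} (hU : IsOpen U) (hUc : IsConnected U)
    {φ q A B C D E f : ℂ → ℂ}
    (hφ : ∀ z ∈ U, HasDerivAt φ (2 * q z * φ z) z) (hφ0 : ∀ z ∈ U, φ z ≠ 0)
    (hA : ∀ z ∈ U, HasDerivAt A (q z * A z) z) (hB : ∀ z ∈ U, HasDerivAt B (q z * B z) z)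
    (hC : ∀ z ∈ U, HasDerivAt C (q z * C z) z) (hD : ∀ z ∈ U, HasDerivAt D (q z * D z) z)
    (hdet : ∀ z ∈ U, A z * D z - B z * C z ≠ 0)
    (hf : ∀ z ∈ U, f z * (C z * E z + D z) = A z * E z + B z) :
    ∃ a b c d : ℂ, a * d - b * c ≠ 0 ∧ ∀ z ∈ U, f z = (a * E z + b) / (c * E z + d) := by
  obtain ⟨z₀, hz₀⟩ := hUc.nonempty
  obtain ⟨H, hH, hH0⟩ : ∃ H : ℂ → ℂ, (∀ z ∈ U, HasDerivAt H (q z * H z) z) ∧ H z₀ ≠ 0 := by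
    by_cases h0 : A z₀ = 0
    · refine ⟨B, hB, fun h1 => hdet z₀ hz₀ ?_⟩
      rw [h0, h1]
      ring
    · exact ⟨A, hA, h0⟩
  refine ⟨A z₀, B z₀, C z₀, D z₀, hdet z₀ hz₀, fun z hz => ?_⟩
  have prop := fun {G : ℂ → ℂ} (hG : ∀ z ∈ U, HasDerivAt G (q z * G z) z) =>
    proportional_of_linear_ode hU hUc.isPreconnected hφ hφ0 hG hH hz₀ hH0 hz
  have hr : H z / H z₀ ≠ 0 := div_ne_zero (prop hA).1 hH0
  have hfz := hf z hz
  rw [(prop hA).2, (prop hB).2, (prop hC).2, (prop hD).2] at hfz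
  have hfz' : f z * (C z₀ * E z + D z₀) = A z₀ * E z + B z₀ :=
    mul_left_cancel₀ hr (by linear_combination hfz)
  have hden : C z₀ * E z + D z₀ ≠ 0 := by
    intro h0
    apply hdet z₀ hz₀
    rw [h0, mul_zero] at hfz'
    linear_combination A z₀ * h0 + C z₀ * hfz'
  rw [eq_div_iff hden, hfz']

/-- an analytic function with nonvanishing derivative and constant
Schwarzian derivative h is a Moebius transform of z (if h = 0) or of an exponential
e^{μz} with μ² = -2h (if h ≠ 0). -/
theorem constant_schwarzian_classification
    (U : Set ℂ) (hU : IsOpen U) (hUne : U.Nonempty) (hUconn : IsConnected U)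
    (h : ℂ) (f : ℂ → ℂ) (hf : AnalyticOnNhd ℂ f U)
    (hf' : ∀ z ∈ U, deriv f z ≠ 0)
    (hS : ∀ z ∈ U, iteratedDeriv 3 f z / deriv f z -
      (3 / 2) * (iteratedDeriv 2 f z / deriv f z) ^ 2 = h) :
    ∃ a b c d : ℂ, a * d - b * c ≠ 0 ∧
      (h = 0 → ∀ z ∈ U, f z = (a * z + b) / (c * z + d)) ∧
      (h ≠ 0 → ∃ μ : ℂ, μ ^ 2 = -2 * h ∧
        ∀ z ∈ U, f z = (a * Complex.exp (μ * z) + b) / (c * Complex.exp (μ * z) + d)) := by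
  -- Half of the pre-Schwarzian `f'' / f'`, which solves the Riccati equation `q' = h / 2 + q ^ 2`.
  set q : ℂ → ℂ := fun z => iteratedDeriv 2 f z / deriv f z / 2 with hq
  have hd1 : ∀ z ∈ U, HasDerivAt f (deriv f z) z := fun z hz =>
    (hf z hz).differentiableAt.hasDerivAt
  have h2 : iteratedDeriv 2 f = deriv (deriv f) := by
    rw [iteratedDeriv_succ, iteratedDeriv_one]
  have h3 : iteratedDeriv 3 f = deriv (deriv (deriv f)) := by
    rw [iteratedDeriv_succ, h2]
  have hd2 : ∀ z ∈ U, HasDerivAt (deriv f) (2 * q z * deriv f z) z := fun z hz =>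
    (hf.deriv z hz).differentiableAt.hasDerivAt.congr_deriv (by
      have := hf' z hz
      simp only [hq, h2]
      field_simp)
  have hdq : ∀ z ∈ U, HasDerivAt q (h / 2 + q z ^ 2) z := by
    intro z hz
    have h0 := hf' z hz
    have hd3 : HasDerivAt (iteratedDeriv 2 f) (iteratedDeriv 3 f z) z := by
      rw [h2, h3]
      exact (hf.deriv.deriv z hz).differentiableAt.hasDerivAt
    refine ((hd3.div (hd2 z hz) h0).div_const 2).congr_deriv ?_
    rw [← hS z hz]
    simp only [hq]
    field_simp
    ring
  by_cases hh : h = 0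
  · subst hh
    have hC : ∀ z ∈ U, HasDerivAt (fun z => -q z) (q z * -q z) z := fun z hz =>
      (hdq z hz).neg.congr_deriv (by ring)
    have hD : ∀ z ∈ U, HasDerivAt (fun z => 1 + z * q z) (q z * (1 + z * q z)) z := fun z hz =>
      (((hasDerivAt_id z).mul (hdq z hz)).const_add 1).congr_deriv (by simp only [id]; ring)
    have hA : ∀ z ∈ U, HasDerivAt (fun z => deriv f z - f z * q z)
        (q z * (deriv f z - f z * q z)) z := fun z hz =>
      ((hd2 z hz).sub ((hd1 z hz).mul (hdq z hz))).congr_deriv (by ring)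
    have hB : ∀ z ∈ U, HasDerivAt (fun z => f z - z * (deriv f z - f z * q z))
        (q z * (f z - z * (deriv f z - f z * q z))) z := fun z hz =>
      ((hd1 z hz).sub ((hasDerivAt_id z).mul (hA z hz))).congr_deriv (by simp only [id]; ring)
    obtain ⟨a, b, c, d, hdet, hform⟩ := exists_moebius_of_linear_ode (E := fun z => z) (f := f)
      hU hUconn hd2 hf' hA hB hC hD
      (fun z hz h0 => hf' z hz (by linear_combination h0))
      (fun z _ => by ring)
    exact ⟨a, b, c, d, hdet, fun _ => hform, fun h0 => absurd rfl h0⟩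
  · obtain ⟨k, hk⟩ : ∃ k : ℂ, k ^ 2 = -h / 2 := IsAlgClosed.exists_pow_nat_eq _ two_pos
    have hk0 : k ≠ 0 := by
      rintro rfl
      exact hh (by linear_combination 2 * hk)
    have hexp : ∀ s z : ℂ, HasDerivAt (fun z => Complex.exp (s * z)) (s * Complex.exp (s * z)) z :=
      fun s z => ((hasDerivAt_id z).const_mul s).cexp.congr_deriv (by simp only [id]; ring)
    have hG : ∀ s : ℂ, s ^ 2 = -h / 2 → ∀ z ∈ U,
        HasDerivAt (fun z => (s - q z) * Complex.exp (-s * z))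
          (q z * ((s - q z) * Complex.exp (-s * z))) z := fun s hs z hz =>
      (((hdq z hz).const_sub s).mul (hexp (-s) z)).congr_deriv (by
        linear_combination -Complex.exp (-s * z) * hs)
    have hK : ∀ s : ℂ, s ^ 2 = -h / 2 → ∀ z ∈ U,
        HasDerivAt (fun z => deriv f z * Complex.exp (-s * z)
            + f z * ((s - q z) * Complex.exp (-s * z)))
          (q z * (deriv f z * Complex.exp (-s * z)
            + f z * ((s - q z) * Complex.exp (-s * z)))) z := fun s hs z hz =>
      (((hd2 z hz).mul (hexp (-s) z)).add ((hd1 z hz).mul (hG s hs z hz))).congr_deriv (by ring)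
    have hneg : ∀ {G : ℂ → ℂ}, (∀ z ∈ U, HasDerivAt G (q z * G z) z) →
        ∀ z ∈ U, HasDerivAt (fun z => -G z) (q z * -G z) z := fun hG z hz =>
      (hG z hz).neg.congr_deriv (by ring)
    have hk' : (-k) ^ 2 = -h / 2 := by rw [neg_sq, hk]
    have hinv : ∀ z : ℂ, Complex.exp (-k * z) * Complex.exp (- -k * z) = 1 := fun z => by
      rw [← Complex.exp_add, ← Complex.exp_zero]
      ring_nf
    have hdouble : ∀ z : ℂ, Complex.exp (-k * z) * Complex.exp (2 * k * z)
        = Complex.exp (- -k * z) := fun z => by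
      rw [← Complex.exp_add]
      ring_nf
    obtain ⟨a, b, c, d, hdet, hform⟩ := exists_moebius_of_linear_ode
      (E := fun z => Complex.exp (2 * k * z)) (f := f) hU hUconn hd2 hf'
      (hK k hk) (hneg (hK (-k) hk')) (hG k hk) (hneg (hG (-k) hk'))
      (fun z hz h0 => mul_ne_zero (mul_ne_zero two_ne_zero hk0) (hf' z hz) (by
        linear_combination h0 - 2 * k * deriv f z * hinv z))
      (fun z _ => by linear_combination -deriv f z * hdouble z)
    exact ⟨a, b, c, d, hdet, fun h0 => absurd h0 hh, fun _ =>
      ⟨2 * k, by linear_combination 4 * hk, hform⟩⟩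
end

section
/- Let A, B ∈ ℂ[x,y] be coprime polynomials with A ≠ 0, and let D = A·∂x + B·∂y denote the associated derivation on ℂ(x,y). Suppose there exists an integer k ≥ 2 and a nonzero G ∈ ℂ(x,y) which is not a k-th power in ℂ(x,y) and satisfies D(G) + k·A·∂y(B/A)·G = 0, and suppose there also exists a nonzero R ∈ ℂ(x,y) satisfying D(R) + A·∂y(B/A)·R = 0. Then there exists a nonconstant J ∈ ℂ(x,y) with D(J) = 0. -/
open MvPolynomial

/-- a planar polynomial vector field possessing both a genuinely
k-Darbouxian first integral (k ≥ 2) and a 1-Darbouxian first integral possesses a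
rational first integral. The derivations Dx, Dy are the unique extensions of the
partial derivatives to the fraction field ℂ(x,y). -/
theorem darbouxian_k_and_one_gives_rational_first_integral
    (A B : MvPolynomial (Fin 2) ℂ) (hA : A ≠ 0) (hAB : IsRelPrime A B)
    (Dx Dy : Derivation ℂ (FractionRing (MvPolynomial (Fin 2) ℂ))
      (FractionRing (MvPolynomial (Fin 2) ℂ)))
    (hDx : ∀ p : MvPolynomial (Fin 2) ℂ,
      Dx (algebraMap _ (FractionRing (MvPolynomial (Fin 2) ℂ)) p)
        = algebraMap _ _ (pderiv (0 : Fin 2) p))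
    (hDy : ∀ p : MvPolynomial (Fin 2) ℂ,
      Dy (algebraMap _ (FractionRing (MvPolynomial (Fin 2) ℂ)) p)
        = algebraMap _ _ (pderiv (1 : Fin 2) p))
    (a b : FractionRing (MvPolynomial (Fin 2) ℂ))
    (ha : a = algebraMap _ _ A) (hb : b = algebraMap _ _ B)
    (k : ℕ) (hk : 2 ≤ k)
    (G : FractionRing (MvPolynomial (Fin 2) ℂ)) (hG : G ≠ 0)
    (hGpow : ¬∃ H : FractionRing (MvPolynomial (Fin 2) ℂ), H ^ k = G)
    (hGeq : a * Dx G + b * Dy G + (k : FractionRing (MvPolynomial (Fin 2) ℂ))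
      * (a * Dy (b / a)) * G = 0)
    (R : FractionRing (MvPolynomial (Fin 2) ℂ)) (hR : R ≠ 0)
    (hReq : a * Dx R + b * Dy R + a * Dy (b / a) * R = 0) :
    ∃ J : FractionRing (MvPolynomial (Fin 2) ℂ),
      (¬∃ c : ℂ, J = algebraMap ℂ _ c) ∧ a * Dx J + b * Dy J = 0 := by
  have hRk : R ^ k ≠ 0 := pow_ne_zero k hR
  refine ⟨G / R ^ k, ?_, ?_⟩
  · rintro ⟨c, hc⟩
    obtain ⟨z, hz⟩ := IsAlgClosed.exists_pow_nat_eq c (show 0 < k by omega)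
    exact hGpow ⟨algebraMap ℂ _ z * R, by
      rw [mul_pow, ← map_pow, hz, ← hc, div_mul_cancel₀ _ hRk]⟩
  · set J := G / R ^ k with hJ
    have hGJ : G = J * R ^ k := by rw [hJ, div_mul_cancel₀ _ hRk]
    obtain ⟨n, rfl⟩ : ∃ n, k = n + 1 := ⟨k - 1, by omega⟩
    rw [hGJ] at hGeq
    simp only [Derivation.leibniz, Derivation.leibniz_pow, smul_eq_mul, nsmul_eq_mul,
      Nat.add_sub_cancel] at hGeq
    refine (mul_eq_zero.mp ?_).resolve_right hRk
    linear_combination hGeq - J * ((n + 1 : ℕ) : FractionRing (MvPolynomial (Fin 2) ℂ))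
      * R ^ n * hReq
end

section
/- Let A, B ∈ ℚ[x,y] and let K be the algebraic closure of ℚ. If there exists a nonconstant rational function J ∈ K(x,y) such that A·∂x J + B·∂y J = 0 in K(x,y), then there exists a nonconstant rational function J' ∈ ℚ(x,y) such that A·∂x J' + B·∂y J' = 0. -/
open MvPolynomial

/-- An additive endomorphism satisfying the Leibniz rule, as a derivation over `ℤ`. -/
def Derivation.ofLeibniz {A : Type*} [CommRing A] (d : A →+ A)
    (h : ∀ a b, d (a * b) = a * d b + b * d a) : Derivation ℤ A A :=
  Derivation.mk' d.toIntLinearMap h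

/-- If `D` extends `d` on a domain `R`, then it extends `d` on the fraction field of `R`. -/
theorem Derivation.map_algebraMap_of_isFractionRing {R F L : Type*} [CommRing R]
    [IsDomain R] [Field F] [Field L] [Algebra R F] [IsFractionRing R F] [Algebra F L]
    (d : Derivation ℤ F F) (D : Derivation ℤ L L)
    (h : ∀ p : R, D (algebraMap F L (algebraMap R F p)) =
      algebraMap F L (d (algebraMap R F p))) (f : F) :
    D (algebraMap F L f) = algebraMap F L (d f) := by
  obtain ⟨p, q, -, rfl⟩ := IsFractionRing.div_surjective (A := R) f
  rw [map_div₀, D.leibniz_div, d.leibniz_div, h, h]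
  simp only [smul_eq_mul, map_mul, map_sub, map_pow, map_inv₀]

/-- If `x` is algebraic over `F` and is killed by a derivation extending a derivation `d` of `F`,
then `d` kills the coefficients of the minimal polynomial of `x`. -/
theorem Derivation.coeff_minpoly_eq_zero {F L : Type*} [Field F] [Field L] [Algebra F L]
    (d : Derivation ℤ F F) (D : Derivation ℤ L L)
    (h : ∀ f : F, D (algebraMap F L f) = algebraMap F L (d f))
    {x : L} (hx : IsIntegral F x) (hDx : D x = 0) (i : ℕ) :
    d ((minpoly F x).coeff i) = 0 := by
  set m := minpoly F x with hm
  have hmonic : m.Monic := minpoly.monic hx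
  let q : Polynomial F :=
    ∑ j ∈ Finset.range m.natDegree, Polynomial.monomial j (d (m.coeff j))
  have hcoeff (j : ℕ) (hj : j < m.natDegree) : q.coeff j = d (m.coeff j) := by
    simp [q, Polynomial.finsetSum_coeff, Polynomial.coeff_monomial, hj]
  have hqx : Polynomial.aeval x q = 0 := by
    have h0 : D (Polynomial.aeval x m) = 0 := by rw [hm, minpoly.aeval, map_zero]
    rw [Polynomial.aeval_eq_sum_range, Finset.sum_range_succ, map_add, map_sum] at h0
    simpa [q, Polynomial.aeval_monomial, Algebra.smul_def, D.leibniz, D.leibniz_pow, hDx, h,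
      hmonic.coeff_natDegree, mul_comm] using h0
  have hqdeg : q.degree < m.degree := by
    rw [Polynomial.degree_eq_natDegree hmonic.ne_zero]
    refine (Polynomial.degree_sum_le _ _).trans_lt ?_
    rw [Finset.sup_lt_iff (WithBot.bot_lt_coe _)]
    intro j hj
    exact (Polynomial.degree_monomial_le _ _).trans_lt
      (WithBot.coe_lt_coe.mpr (Finset.mem_range.mp hj))
  have hq0 : q = 0 := by
    by_contra hne
    exact absurd (minpoly.degree_le_of_ne_zero F x hne hqx) (not_le.mpr hqdeg)
  rcases lt_trichotomy i m.natDegree with hi | rfl | hi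
  · rw [← hcoeff i hi, hq0, Polynomial.coeff_zero]
  · rw [hmonic.coeff_natDegree, d.map_one_eq_zero]
  · rw [Polynomial.coeff_eq_zero_of_natDegree_lt hi, map_zero]

/-- An integral element of a field extension of an algebraically closed field lies in the base. -/
theorem IsAlgClosed.mem_range_algebraMap_of_isIntegral {K L : Type*} [Field K] [IsAlgClosed K]
    [Field L] [Algebra K L] {x : L} (hx : IsIntegral K x) : x ∈ (algebraMap K L).range :=
  minpoly.mem_range_of_degree_eq_one K x
    (IsAlgClosed.degree_eq_one_of_irreducible K (minpoly.irreducible hx))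

/-- Let `L / F` be an algebraic field extension with compatible derivations, where `F` and `L` are
extensions of a field `k` and of an algebraically closed field `K ⊇ k`. If `D` kills some element
of `L` outside `K`, then `d` kills some element of `F` outside `k`. -/
theorem Derivation.exists_eq_zero_of_isAlgebraic {k K F L : Type*} [Field k] [Field K]
    [IsAlgClosed K] [Field F] [Field L] [Algebra k K] [Algebra F L] [Algebra.IsAlgebraic F L]
    [Algebra k F] [Algebra K L]
    (hk : (algebraMap F L).comp (algebraMap k F) = (algebraMap K L).comp (algebraMap k K))
    (d : Derivation ℤ F F) (D : Derivation ℤ L L)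
    (hD : ∀ f : F, D (algebraMap F L f) = algebraMap F L (d f))
    {x : L} (hx : ¬∃ c : K, x = algebraMap K L c) (hDx : D x = 0) :
    ∃ f : F, (¬∃ c : k, f = algebraMap k F c) ∧ d f = 0 := by
  have hxint : IsIntegral F x := (Algebra.IsAlgebraic.isAlgebraic x).isIntegral
  have hcoeff := Derivation.coeff_minpoly_eq_zero d D hD hxint hDx
  by_contra! hcon
  have hconst (i : ℕ) : ∃ c : k, (minpoly F x).coeff i = algebraMap k F c := by
    by_contra hc
    exact hcon _ (not_exists.mp hc) (hcoeff i)
  obtain ⟨q, hq⟩ : ∃ q : Polynomial k, q.map (algebraMap k F) = minpoly F x := by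
    rw [← Polynomial.mem_lifts, Polynomial.lifts_iff_coeff_lifts]
    exact fun i ↦ (hconst i).imp fun c hc ↦ hc.symm
  have hqmonic : q.Monic :=
    Polynomial.monic_of_injective (algebraMap k F).injective (hq ▸ minpoly.monic hxint)
  have hxK : IsIntegral K x := by
    refine ⟨q.map (algebraMap k K), hqmonic.map _, ?_⟩
    have h0 := minpoly.aeval F x
    rwa [← hq, Polynomial.aeval_def, Polynomial.eval₂_map, hk, ← Polynomial.eval₂_map] at h0
  obtain ⟨c, hc⟩ := IsAlgClosed.mem_range_algebraMap_of_isIntegral hxK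
  exact hx ⟨c, hc.symm⟩

/-- `F(X)` embeds into `K(X)`, compatibly with polynomials, so that the extension is algebraic. -/
theorem MvPolynomial.exists_algebra_fractionRing_isAlgebraic (σ F K : Type*) [Field F] [Field K]
    [Algebra F K] [Algebra.IsAlgebraic F K] :
    ∃ _ : Algebra (FractionRing (MvPolynomial σ F)) (FractionRing (MvPolynomial σ K)),
      (∀ p : MvPolynomial σ F,
        algebraMap (FractionRing (MvPolynomial σ F)) (FractionRing (MvPolynomial σ K))
          (algebraMap _ _ p) = algebraMap _ _ (MvPolynomial.map (algebraMap F K) p)) ∧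
      Algebra.IsAlgebraic (FractionRing (MvPolynomial σ F))
        (FractionRing (MvPolynomial σ K)) := by
  let : Algebra (MvPolynomial σ F) (MvPolynomial σ K) := MvPolynomial.algebraMvPolynomial
  have hinj : Function.Injective
      (algebraMap (MvPolynomial σ F) (FractionRing (MvPolynomial σ K))) := by
    rw [IsScalarTower.algebraMap_eq (MvPolynomial σ F) (MvPolynomial σ K)
      (FractionRing (MvPolynomial σ K)), RingHom.coe_comp]
    exact (IsFractionRing.injective _ _).comp
      (MvPolynomial.map_injective _ (algebraMap F K).injective)
  have : FaithfulSMul (MvPolynomial σ F) (FractionRing (MvPolynomial σ K)) :=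
    (faithfulSMul_iff_algebraMap_injective _ _).mpr hinj
  let := FractionRing.liftAlgebra (MvPolynomial σ F) (FractionRing (MvPolynomial σ K))
  have := FractionRing.isScalarTower_liftAlgebra (MvPolynomial σ F)
    (FractionRing (MvPolynomial σ K))
  refine ⟨inferInstance, fun p ↦ ?_, ?_⟩
  · rw [← IsScalarTower.algebraMap_apply, IsScalarTower.algebraMap_apply (MvPolynomial σ F)
      (MvPolynomial σ K)]
    rfl
  · rw [← IsFractionRing.comap_isAlgebraic_iff (A := MvPolynomial σ F),
      ← IsFractionRing.isAlgebraic_iff' (MvPolynomial σ F) (MvPolynomial σ K)]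
    infer_instance

/-- if a planar polynomial vector field with rational coefficients admits a
nonconstant rational first integral with coefficients in the algebraic closure of ℚ, then
it admits one with coefficients in ℚ. The derivations are the unique extensions of the
partial derivatives to the respective fraction fields. -/
theorem rational_first_integral_descends_to_Q
    (A B : MvPolynomial (Fin 2) ℚ)
    (DxK DyK : Derivation (AlgebraicClosure ℚ)
      (FractionRing (MvPolynomial (Fin 2) (AlgebraicClosure ℚ)))
      (FractionRing (MvPolynomial (Fin 2) (AlgebraicClosure ℚ))))
    (hDxK : ∀ p : MvPolynomial (Fin 2) (AlgebraicClosure ℚ),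
      DxK (algebraMap _ (FractionRing (MvPolynomial (Fin 2) (AlgebraicClosure ℚ))) p)
        = algebraMap _ _ (pderiv (0 : Fin 2) p))
    (hDyK : ∀ p : MvPolynomial (Fin 2) (AlgebraicClosure ℚ),
      DyK (algebraMap _ (FractionRing (MvPolynomial (Fin 2) (AlgebraicClosure ℚ))) p)
        = algebraMap _ _ (pderiv (1 : Fin 2) p))
    (DxQ DyQ : Derivation ℚ (FractionRing (MvPolynomial (Fin 2) ℚ))
      (FractionRing (MvPolynomial (Fin 2) ℚ)))
    (hDxQ : ∀ p : MvPolynomial (Fin 2) ℚ,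
      DxQ (algebraMap _ (FractionRing (MvPolynomial (Fin 2) ℚ)) p)
        = algebraMap _ _ (pderiv (0 : Fin 2) p))
    (hDyQ : ∀ p : MvPolynomial (Fin 2) ℚ,
      DyQ (algebraMap _ (FractionRing (MvPolynomial (Fin 2) ℚ)) p)
        = algebraMap _ _ (pderiv (1 : Fin 2) p))
    (J : FractionRing (MvPolynomial (Fin 2) (AlgebraicClosure ℚ)))
    (hJconst : ¬∃ c : AlgebraicClosure ℚ, J = algebraMap (AlgebraicClosure ℚ) _ c)
    (hJ : algebraMap _ (FractionRing (MvPolynomial (Fin 2) (AlgebraicClosure ℚ)))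
        (MvPolynomial.map (algebraMap ℚ (AlgebraicClosure ℚ)) A) * DxK J
      + algebraMap _ _ (MvPolynomial.map (algebraMap ℚ (AlgebraicClosure ℚ)) B) * DyK J
      = 0) :
    ∃ J' : FractionRing (MvPolynomial (Fin 2) ℚ),
      (¬∃ c : ℚ, J' = algebraMap ℚ _ c) ∧
      algebraMap _ (FractionRing (MvPolynomial (Fin 2) ℚ)) A * DxQ J'
        + algebraMap _ _ B * DyQ J' = 0 := by
  have : Algebra.IsAlgebraic ℚ (AlgebraicClosure ℚ) := by
    rw [Subsingleton.elim DivisionRing.toRatAlgebra (AlgebraicClosure.instAlgebra ℚ)]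
    exact AlgebraicClosure.isAlgebraic ℚ
  obtain ⟨_, hmap, _⟩ :=
    MvPolynomial.exists_algebra_fractionRing_isAlgebraic (Fin 2) ℚ (AlgebraicClosure ℚ)
  let dxQ := Derivation.ofLeibniz (AddMonoidHomClass.toAddMonoidHom DxQ) DxQ.leibniz
  let dyQ := Derivation.ofLeibniz (AddMonoidHomClass.toAddMonoidHom DyQ) DyQ.leibniz
  let dxK := Derivation.ofLeibniz (AddMonoidHomClass.toAddMonoidHom DxK) DxK.leibniz
  let dyK := Derivation.ofLeibniz (AddMonoidHomClass.toAddMonoidHom DyK) DyK.leibniz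
  refine Derivation.exists_eq_zero_of_isAlgebraic (Subsingleton.elim _ _)
    (algebraMap _ (FractionRing (MvPolynomial (Fin 2) ℚ)) A • dxQ
      + algebraMap _ (FractionRing (MvPolynomial (Fin 2) ℚ)) B • dyQ)
    (algebraMap _ (FractionRing (MvPolynomial (Fin 2) (AlgebraicClosure ℚ)))
        (MvPolynomial.map (algebraMap ℚ (AlgebraicClosure ℚ)) A) • dxK
      + algebraMap _ (FractionRing (MvPolynomial (Fin 2) (AlgebraicClosure ℚ)))
        (MvPolynomial.map (algebraMap ℚ (AlgebraicClosure ℚ)) B) • dyK)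
    (Derivation.map_algebraMap_of_isFractionRing (R := MvPolynomial (Fin 2) ℚ) _ _ fun p ↦ ?_)
    hJconst hJ
  have hxQ : dxQ (algebraMap _ _ p) = algebraMap _ _ (pderiv 0 p) := hDxQ p
  have hxK : dxK (algebraMap _ _ (MvPolynomial.map (algebraMap ℚ (AlgebraicClosure ℚ)) p)) =
      algebraMap _ _ (pderiv 0 (MvPolynomial.map (algebraMap ℚ (AlgebraicClosure ℚ)) p)) :=
    hDxK _
  have hyQ : dyQ (algebraMap _ _ p) = algebraMap _ _ (pderiv 1 p) := hDyQ p
  have hyK : dyK (algebraMap _ _ (MvPolynomial.map (algebraMap ℚ (AlgebraicClosure ℚ)) p)) =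
      algebraMap _ _ (pderiv 1 (MvPolynomial.map (algebraMap ℚ (AlgebraicClosure ℚ)) p)) :=
    hDyK _
  simp only [Derivation.add_apply, Derivation.smul_apply, smul_eq_mul, map_add, map_mul,
    hmap, hxQ, hyQ, hxK, hyK, MvPolynomial.pderiv_map]
end
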